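/- arXiv:2502.03551 — 2 statements merged into one kernel-verified Lean document; each statement's English description precedes it below -/
import Mathlib

section
/- Let θ = 1 and α = κ/η ∈ (0, 1/2), suppose the φ-mixing coefficients of the stationary Markov chain satisfy φ_m ≤ D r^m for all m ≥ 1, for some constants D > 0 and 0 < r < 1, and let the step sizes be γ_s = 1/(η s). Then for every t ≥ 2 and every δ ∈ (0,1), with μ_{t−1}-probability at least 1 − δ over trajectories (z_1, …, z_{t−1}) ∈ Z^{t−1}, the SS-MGD iterate w_t satisfies ‖w_t − w*‖ ≤ (1/t)^α·‖w_1 − w*‖ + [ (4σ²/(δ η²)) · (1/(1−2α)) · (1/t)^α · (1 + 6Dr/(1−r)) ]^{1/2}. -/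
open MeasureTheory ProbabilityTheory
open scoped ENNReal RealInnerProductSpace

/-- The `m`-step transition kernel obtained by iterating `P`. -/
noncomputable def kernelIter {Z : Type*} [MeasurableSpace Z] (P : Kernel Z Z) : ℕ → Kernel Z Z
  | 0 => Kernel.id
  | m + 1 => (kernelIter P m).comp P

/-- The φ-mixing coefficient of the stationary Markov chain with kernel `P` and
invariant distribution `ρ`. -/
noncomputable def phiCoef {Z : Type*} [MeasurableSpace Z] (P : Kernel Z Z) (ρ : Measure Z)
    (m : ℕ) : ℝ :=
  essSup (fun z => ⨆ B : {B : Set Z // MeasurableSet B},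
    |(kernelIter P m z B.1).toReal - (ρ B.1).toReal|) ρ

/-- Kernel giving the conditional law of the next state given the trajectory so far
(for the empty trajectory, the initial distribution `ρ`). -/
noncomputable def stepKernel {Z : Type*} [MeasurableSpace Z] (P : Kernel Z Z) (ρ : Measure Z) :
    (n : ℕ) → Kernel (Fin n → Z) Z
  | 0 => Kernel.const _ ρ
  | n + 1 => P.comap (fun v => v (Fin.last n)) (measurable_pi_apply _)

/-- The joint law on `Z^n` of the first `n` states of the stationary Markov chain,
obtained from initial distribution `ρ` by iterated composition-product with `P`. -/
noncomputable def trajMeasure {Z : Type*} [MeasurableSpace Z] (P : Kernel Z Z) (ρ : Measure Z) :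
    (n : ℕ) → Measure (Fin n → Z)
  | 0 => Measure.dirac (fun x : Fin 0 => x.elim0)
  | n + 1 => (Measure.compProd (trajMeasure P ρ n) (stepKernel P ρ n)).map
      (fun p => Fin.snoc p.1 p.2)

/-! ### Real estimates -/

lemma rpow_succ_le {α x : ℝ} (h0 : 0 ≤ α) (h1 : α ≤ 1) (hx : 0 < x) :
    (x + 1) ^ α ≤ x ^ α * (1 + α / x) := by
  have hb : (1 + 1 / x) ^ α ≤ 1 + α * (1 / x) :=
    rpow_one_add_le_one_add_mul_self (by linarith [one_div_pos.2 hx]) h0 h1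
  have hs : (x + 1) ^ α = x ^ α * (1 + 1 / x) ^ α := by
    rw [← Real.mul_rpow hx.le (by positivity)]
    congr 1
    field_simp
  rw [hs]
  have : α / x = α * (1 / x) := by ring
  rw [this]
  gcongr

lemma one_sub_div_mul_rpow_le {α t : ℝ} (h0 : 0 ≤ α) (h1 : α ≤ 1) (ht : 1 ≤ t) :
    (1 - α / t) * (t + 1) ^ α ≤ t ^ α := by
  have ht0 : 0 < t := by linarith
  have hq : α / t ≤ 1 := by rw [div_le_one ht0]; linarith
  have hp : 0 ≤ t ^ α := by positivity
  nlinarith [mul_le_mul_of_nonneg_left (rpow_succ_le h0 h1 ht0) (sub_nonneg.2 hq),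
    mul_nonneg hp (sq_nonneg (α / t))]

lemma mul_rpow_neg_le_sub {p x : ℝ} (hp : 0 < p) (hx : 0 < x) :
    p * (x + 1) ^ (-p - 1) ≤ x ^ (-p) - (x + 1) ^ (-p) := by
  have hx1 : 0 < x + 1 := by linarith
  have hy : 0 < (x + 1) / x := by positivity
  have hlog : 1 / (x + 1) ≤ Real.log ((x + 1) / x) := by
    have := Real.one_sub_inv_le_log_of_pos hy
    have e : 1 - ((x + 1) / x)⁻¹ = 1 / (x + 1) := by field_simp; ring
    linarith
  have hexp : 1 + p * (1 / (x + 1)) ≤ ((x + 1) / x) ^ p := by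
    rw [Real.rpow_def_of_pos hy]
    have h1 := Real.add_one_le_exp (Real.log ((x + 1) / x) * p)
    nlinarith
  have hs : x ^ (-p) = (x + 1) ^ (-p) * ((x + 1) / x) ^ p := by
    rw [Real.div_rpow hx1.le hx.le, Real.rpow_neg hx.le, Real.rpow_neg hx1.le]
    have : (x + 1) ^ p ≠ 0 := by positivity
    field_simp
  have hd : (x + 1) ^ (-p - 1) = (x + 1) ^ (-p) * (1 / (x + 1)) := by
    rw [Real.rpow_sub_one hx1.ne']; ring
  have hnn : 0 ≤ (x + 1) ^ (-p) := by positivity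
  rw [hs, hd]
  nlinarith [mul_le_mul_of_nonneg_left hexp hnn]

lemma rpow_neg_sub_one_eq {α x : ℝ} (hx : 0 < x) :
    x ^ (-(1 / 2 - α) - 1) = x ^ α / (x * √x) := by
  rw [show -(1 / 2 - α) - 1 = α - 1 / 2 - 1 by ring, Real.rpow_sub_one hx.ne', Real.rpow_sub hx,
    Real.sqrt_eq_rpow]
  field_simp

lemma weight_div_sqrt_le {α x : ℝ} (h0 : 0 ≤ α) (h1 : α < 1 / 2) (hx : 1 ≤ x) :
    (x + 2) ^ α / (x + 1) / √x ≤
      2 / (1 / 2 - α) * (x ^ (-(1 / 2 - α)) - (x + 1) ^ (-(1 / 2 - α))) := by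
  have hp : 0 < 1 / 2 - α := by linarith
  have hx0 : 0 < x := by linarith
  have hx1 : 0 < x + 1 := by linarith
  have hm := mul_rpow_neg_le_sub hp hx0
  rw [rpow_neg_sub_one_eq hx1] at hm
  have hsucc := rpow_succ_le h0 (by linarith) hx1
  have hfrac : α / (x + 1) ≤ 1 / 4 := by
    rw [div_le_iff₀ hx1]; linarith
  have hs : √(x + 1) ≤ 3 / 2 * √x := by
    rw [Real.sqrt_le_iff]
    refine ⟨by positivity, ?_⟩
    rw [mul_pow, Real.sq_sqrt hx0.le]; linarith
  have hsx : 0 < √x := Real.sqrt_pos.2 hx0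
  have hsx1 : 0 < √(x + 1) := Real.sqrt_pos.2 hx1
  have hpow : 0 < (x + 1) ^ α := by positivity
  have key : (x + 2) ^ α / (x + 1) / √x ≤ 2 * ((x + 1) ^ α / ((x + 1) * √(x + 1))) := by
    rw [show x + 1 + 1 = x + 2 by ring] at hsucc
    have hA : (x + 2) ^ α ≤ (x + 1) ^ α * (5 / 4) :=
      hsucc.trans (by gcongr; linarith)
    rw [div_div, div_le_iff₀ (by positivity)]
    have : 2 * ((x + 1) ^ α / ((x + 1) * √(x + 1))) * ((x + 1) * √x)
        = (x + 1) ^ α * (2 * (√x / √(x + 1))) := by field_simp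
    rw [this]
    refine hA.trans ?_
    gcongr
    have : 2 / 3 ≤ √x / √(x + 1) := by rw [le_div_iff₀ hsx1]; linarith
    linarith
  refine key.trans ?_
  rw [div_mul_eq_mul_div, le_div_iff₀ hp]
  linarith

lemma weight_div_mul_le {α x : ℝ} (h0 : 0 ≤ α) (h1 : α < 1 / 2) (hx : 2 ≤ x) :
    (x + 2) ^ α / ((x + 1) * x) ≤
      5 / 4 / (1 / 2 - α) * (x ^ (-(1 / 2 - α)) - (x + 1) ^ (-(1 / 2 - α))) := by
  have hp : 0 < 1 / 2 - α := by linarith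
  have hx0 : 0 < x := by linarith
  have hx1 : 0 < x + 1 := by linarith
  have hm := mul_rpow_neg_le_sub hp hx0
  rw [rpow_neg_sub_one_eq hx1] at hm
  have hsucc := rpow_succ_le h0 (by linarith) hx1
  rw [show x + 1 + 1 = x + 2 by ring] at hsucc
  have hfrac : α / (x + 1) ≤ 1 / 6 := by
    rw [div_le_iff₀ hx1]; linarith
  have hsx1 : 0 < √(x + 1) := Real.sqrt_pos.2 hx1
  have hs : √(x + 1) ≤ (x + 5) / 4 := by
    nlinarith [sq_nonneg (√(x + 1) - 2), Real.sq_sqrt hx1.le]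
  have hpow : 0 < (x + 1) ^ α := by positivity
  have key : (x + 2) ^ α / ((x + 1) * x) ≤ 5 / 4 * ((x + 1) ^ α / ((x + 1) * √(x + 1))) := by
    have hA : (x + 2) ^ α ≤ (x + 1) ^ α * (7 / 6) :=
      hsucc.trans (by gcongr; linarith)
    rw [div_le_iff₀ (by positivity)]
    have : 5 / 4 * ((x + 1) ^ α / ((x + 1) * √(x + 1))) * ((x + 1) * x)
        = (x + 1) ^ α * (5 / 4 * (x / √(x + 1))) := by field_simp
    rw [this]
    refine hA.trans ?_
    gcongr
    have : 14 / 15 ≤ x / √(x + 1) := by rw [le_div_iff₀ hsx1]; linarith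
    linarith
  refine key.trans ?_
  rw [div_mul_eq_mul_div (5 / 4), le_div_iff₀ hp]
  linarith

/-- Geometric convolution `∑ s < n, r ^ (n - s) / √(s + 1)`, in recursive form. -/
noncomputable def mixConv (r : ℝ) : ℕ → ℝ
  | 0 => 0
  | n + 1 => r * (mixConv r n + 1 / √(n + 1))

lemma mixConv_nonneg {r : ℝ} (hr : 0 ≤ r) (n : ℕ) : 0 ≤ mixConv r n := by
  induction n with
  | zero => simp [mixConv]
  | succ n ih => rw [mixConv]; positivity

lemma weight_antitone {α x : ℝ} (h0 : 0 ≤ α) (h1 : α < 1 / 2) (hx : 1 ≤ x) :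
    (x + 2) ^ α / (x + 1) ≤ (x + 1) ^ α / x := by
  have hsucc := rpow_succ_le (x := x + 1) h0 (by linarith) (by linarith)
  rw [show x + 1 + 1 = x + 2 by ring] at hsucc
  have hpow : 0 < (x + 1) ^ α := by positivity
  have hq : α / (x + 1) ≤ 1 / x := by
    rw [div_le_div_iff₀ (by linarith) (by linarith)]; nlinarith
  rw [div_le_iff₀ (by linarith)]
  refine hsucc.trans ?_
  have : (x + 1) ^ α / x * (x + 1) = (x + 1) ^ α * (1 + 1 / x) := by field_simp
  rw [this]
  gcongr

lemma sum_weight_mixConv_le {α r : ℝ} (h0 : 0 ≤ α) (h1 : α < 1 / 2) (hr0 : 0 ≤ r) (hr1 : r < 1)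
    (n : ℕ) :
    ∑ k ∈ Finset.range n, ((k : ℝ) + 2) ^ α / (k + 1) * mixConv r k ≤
      r / (1 - r) * (2 / (1 / 2 - α)) := by
  have hr : 0 < 1 - r := by linarith
  have hp : 0 < 1 / 2 - α := by linarith
  have key : ∀ n : ℕ, ∑ k ∈ Finset.range n, ((k : ℝ) + 2) ^ α / (k + 1) * mixConv r k
      + ((n : ℝ) + 2) ^ α / (n + 1) * mixConv r n / (1 - r) ≤
      r / (1 - r) * (2 / (1 / 2 - α)) * (1 - ((n : ℝ) + 1) ^ (-(1 / 2 - α))) := by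
    intro n
    induction n with
    | zero => simp [mixConv]
    | succ n ih =>
      rw [Finset.sum_range_succ, mixConv]
      push_cast
      have hw := weight_div_sqrt_le (x := (n : ℝ) + 1) h0 h1 (by linarith [n.cast_nonneg (α := ℝ)])
      have ha := weight_antitone (x := (n : ℝ) + 1) h0 h1 (by linarith [n.cast_nonneg (α := ℝ)])
      rw [show (n : ℝ) + 1 + 1 = n + 2 by ring] at hw ha
      rw [show (n : ℝ) + 1 + 1 = n + 2 by ring]
      have hc := mixConv_nonneg hr0 n
      set c := mixConv r n
      set b := ((n : ℝ) + 2) ^ α / (n + 1)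
      set b' := ((n : ℝ) + 1 + 2) ^ α / (n + 2)
      have hq : 0 ≤ r / (1 - r) := by positivity
      have e1 : b' * (r * (c + 1 / √(n + 1))) / (1 - r)
          = r / (1 - r) * (b' * c) + r / (1 - r) * (b' / √(n + 1)) := by
        field_simp
      have e2 : b * c / (1 - r) = b * c + r / (1 - r) * (b * c) := by field_simp; ring
      rw [e1]
      rw [e2] at ih
      have i1 := mul_le_mul_of_nonneg_left (mul_le_mul_of_nonneg_right ha hc) hq
      have i2 := mul_le_mul_of_nonneg_left hw hq
      linarith
  have hk := key n
  have hc := mixConv_nonneg hr0 n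
  have h2 : 0 ≤ ((n : ℝ) + 2) ^ α / (n + 1) * mixConv r n / (1 - r) := by positivity
  have h3 : 0 ≤ r / (1 - r) * (2 / (1 / 2 - α)) * ((n : ℝ) + 1) ^ (-(1 / 2 - α)) := by positivity
  linarith

lemma sum_weight_diag_le {α : ℝ} (h0 : 0 ≤ α) (h1 : α < 1 / 2) (n : ℕ) :
    2 ^ α + ∑ k ∈ Finset.range n, ((k : ℝ) + 3) ^ α / ((k + 2) * (k + 1)) ≤ 4 / (1 - 2 * α) := by
  have hp : 0 < 1 / 2 - α := by linarith
  have hd : 0 < 1 - 2 * α := by linarith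
  have h3 : (3 : ℝ) ^ α ≤ 1 / (1 - 2 * α) := by
    have hb := rpow_one_add_le_one_add_mul_self (s := 2) (by norm_num) h0 (by linarith : α ≤ 1)
    rw [show (1 : ℝ) + 2 = 3 by norm_num] at hb
    refine hb.trans ?_
    rw [le_div_iff₀ hd]; nlinarith
  have h2 : (2 : ℝ) ^ α ≤ 1 / (1 - 2 * α) :=
    (Real.rpow_le_rpow (by norm_num) (by norm_num) h0).trans h3
  have key : ∀ n : ℕ, 2 ^ α + ∑ k ∈ Finset.range (n + 1), ((k : ℝ) + 3) ^ α / ((k + 2) * (k + 1)) ≤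
      3 / 2 * (1 / (1 - 2 * α)) +
        5 / 4 / (1 / 2 - α) * (1 - ((n : ℝ) + 2) ^ (-(1 / 2 - α))) := by
    intro n
    induction n with
    | zero =>
      have : (2 : ℝ) ^ (-(1 / 2 - α)) ≤ 1 :=
        Real.rpow_le_one_of_one_le_of_nonpos (by norm_num) (by linarith)
      have : 0 ≤ 5 / 4 / (1 / 2 - α) * (1 - (2 : ℝ) ^ (-(1 / 2 - α))) :=
        mul_nonneg (by positivity) (by linarith)
      simp only [zero_add, Finset.sum_range_one, Nat.cast_zero]
      norm_num at *
      linarith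
    | succ n ih =>
      rw [Finset.sum_range_succ]
      have hw := weight_div_mul_le (x := (n : ℝ) + 2) h0 h1 (by linarith [n.cast_nonneg (α := ℝ)])
      push_cast
      rw [show (n : ℝ) + 1 + 3 = n + 2 + 2 by ring, show (n : ℝ) + 1 + 2 = n + 2 + 1 by ring,
        show (n : ℝ) + 1 + 1 = n + 2 by ring]
      linarith
  have e : 5 / 4 / (1 / 2 - α) = 5 / 2 * (1 / (1 - 2 * α)) := by
    field_simp; ring
  have e4 : 4 / (1 - 2 * α) = 4 * (1 / (1 - 2 * α)) := by ring
  have hpos : 0 < 1 / (1 - 2 * α) := by positivity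
  rcases n with _ | n
  · simp only [Finset.range_zero, Finset.sum_empty]; linarith
  · have hk := key n
    have : 0 ≤ 5 / 4 / (1 / 2 - α) * ((n : ℝ) + 2) ^ (-(1 / 2 - α)) := by positivity
    linarith

/-- A contraction recursion with geometrically mixing perturbations. -/
lemma weighted_recursion_le {α r D τ : ℝ} (h0 : 0 ≤ α) (h1 : α < 1 / 2) (hr0 : 0 ≤ r)
    (hr1 : r < 1) (hD : 0 ≤ D) (u : ℕ → ℝ) (hu0 : ∀ n, 0 ≤ u n) (hu1 : u 1 ≤ τ ^ 2)
    (hu : ∀ n : ℕ, 1 ≤ n → u (n + 1) ≤ (1 - α / (n + 1)) * u n + τ ^ 2 / ((n + 1) * n)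
      + 2 / (n + 1) * (3 * τ ^ 2 * D * mixConv r n)) (n : ℕ) (hn : 1 ≤ n) :
    ((n : ℝ) + 1) ^ α * u n ≤ 4 * τ ^ 2 * (1 / (1 - 2 * α)) * (1 + 6 * D * r / (1 - r)) := by
  have key : ∀ n : ℕ, ((n : ℝ) + 2) ^ α * u (n + 1) ≤
      τ ^ 2 * (2 ^ α + ∑ k ∈ Finset.range n, ((k : ℝ) + 3) ^ α / ((k + 2) * (k + 1))) +
      6 * D * τ ^ 2 *
        ∑ k ∈ Finset.range (n + 1), ((k : ℝ) + 2) ^ α / (k + 1) * mixConv r k := by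
    intro n
    induction n with
    | zero =>
      simp only [Nat.cast_zero, zero_add, Finset.range_zero, Finset.sum_empty, Finset.sum_range_one,
        mixConv]
      have : (0 : ℝ) < 2 ^ α := by positivity
      nlinarith
    | succ n ih =>
      rw [Finset.sum_range_succ, Finset.sum_range_succ (n := n + 1)]
      have hs := hu (n + 1) (by omega)
      push_cast at hs ⊢
      have hc := one_sub_div_mul_rpow_le (t := (n : ℝ) + 2) h0 (by linarith)
        (by linarith [n.cast_nonneg (α := ℝ)])
      rw [show (n : ℝ) + 1 + 1 = n + 2 by ring] at hs ⊢
      rw [show (n : ℝ) + 1 + 2 = n + 3 by ring]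
      rw [show (n : ℝ) + 2 + 1 = n + 3 by ring] at hc
      have i1 := mul_le_mul_of_nonneg_left hs (by positivity : 0 ≤ ((n : ℝ) + 3) ^ α)
      have i2 := mul_le_mul_of_nonneg_right hc (hu0 (n + 1))
      have e : ((n : ℝ) + 3) ^ α * ((1 - α / (n + 2)) * u (n + 1) + τ ^ 2 / ((n + 2) * (n + 1))
          + 2 / (n + 2) * (3 * τ ^ 2 * D * mixConv r (n + 1))) =
          (1 - α / (n + 2)) * (n + 3) ^ α * u (n + 1)
          + τ ^ 2 * ((n + 3) ^ α / ((n + 2) * (n + 1)))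
          + 6 * D * τ ^ 2 * ((n + 3) ^ α / (n + 2) * mixConv r (n + 1)) := by ring
      linarith
  obtain ⟨n, rfl⟩ : ∃ k, n = k + 1 := ⟨n - 1, by omega⟩
  have hk := key n
  have hr : 0 < 1 - r := by linarith
  have hd : 0 < 1 - 2 * α := by linarith
  have j1 := mul_le_mul_of_nonneg_left (sum_weight_diag_le h0 h1 n) (sq_nonneg τ)
  have j2 := mul_le_mul_of_nonneg_left (sum_weight_mixConv_le h0 h1 hr0 hr1 (n + 1))
    (by positivity : 0 ≤ 6 * D * τ ^ 2)
  have e : 2 / (1 / 2 - α) = 4 * (1 / (1 - 2 * α)) := by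
    have : 1 / 2 - α ≠ 0 := by linarith
    field_simp
    ring
  rw [e] at j2
  push_cast
  rw [show (n : ℝ) + 1 + 1 = n + 2 by ring]
  refine (hk.trans (add_le_add j1 j2)).trans_eq ?_
  ring

/-! ### Positive operators -/

section Operator

variable {W : Type*} [NormedAddCommGroup W] [InnerProductSpace ℝ W] [CompleteSpace W]

lemma norm_apply_sq_le_of_isSelfAdjoint {T : W →L[ℝ] W} {c : ℝ} (hT : IsSelfAdjoint T)
    (hc : 0 < c) (h0 : ∀ w, 0 ≤ ⟪T w, w⟫) (h1 : ∀ w, ⟪T w, w⟫ ≤ c * ‖w‖ ^ 2) (x : W) :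
    ‖T x‖ ^ 2 ≤ c * ⟪T x, x⟫ := by
  have hsymm : ∀ v w : W, ⟪T v, w⟫ = ⟪v, T w⟫ := fun v w => hT.isSymmetric v w
  have a := h1 (T x)
  have b := h0 (c • x - T x)
  simp only [map_sub, map_smul, inner_sub_left, inner_sub_right, real_inner_smul_left,
    real_inner_smul_right] at b
  rw [hsymm (T x) x, real_inner_self_eq_norm_sq] at b
  nlinarith

lemma norm_apply_le_of_isSelfAdjoint {T : W →L[ℝ] W} {c : ℝ} (hT : IsSelfAdjoint T)
    (hc : 0 < c) (h0 : ∀ w, 0 ≤ ⟪T w, w⟫) (h1 : ∀ w, ⟪T w, w⟫ ≤ c * ‖w‖ ^ 2) (x : W) :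
    ‖T x‖ ≤ c * ‖x‖ := by
  have a := norm_apply_sq_le_of_isSelfAdjoint hT hc h0 h1 x
  have b := real_inner_le_norm (T x) x
  by_contra! h
  have hx := norm_nonneg x
  have : 0 < ‖T x‖ := lt_of_le_of_lt (by positivity) h
  nlinarith

lemma norm_sub_smul_apply_le {T : W →L[ℝ] W} {α t : ℝ} (hT : IsSelfAdjoint T)
    (hα : α < 1) (hα0 : 0 < α) (ht : 1 ≤ t) (h0 : ∀ w, α * ‖w‖ ^ 2 ≤ ⟪T w, w⟫)
    (h1 : ∀ w, ⟪T w, w⟫ ≤ ‖w‖ ^ 2) (x : W) :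
    ‖x - (1 / t) • T x‖ ≤ (1 - α / t) * ‖x‖ := by
  have ht0 : 0 < t := by linarith
  have hs : IsSelfAdjoint (ContinuousLinearMap.id ℝ W - (1 / t) • T) := by
    refine IsSelfAdjoint.sub ?_ ?_
    · exact IsSelfAdjoint.one (W →L[ℝ] W)
    · exact IsSelfAdjoint.smul (by simp [IsSelfAdjoint]) hT
  have hinner : ∀ w : W, ⟪(ContinuousLinearMap.id ℝ W - (1 / t) • T) w, w⟫
      = ‖w‖ ^ 2 - 1 / t * ⟪T w, w⟫ := fun w => by
    simp [inner_sub_left, real_inner_smul_left]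
  have ht1 : 1 / t ≤ 1 := by rw [div_le_one ht0]; exact ht
  have ht2 : 0 < 1 / t := by positivity
  have hpos : 0 < 1 - α / t := by
    have : α / t < 1 := by rw [div_lt_one ht0]; linarith
    linarith
  have := norm_apply_le_of_isSelfAdjoint hs hpos (fun w => by
    rw [hinner]
    nlinarith [h1 w, sq_nonneg ‖w‖]) (fun w => by
    rw [hinner]
    have := mul_le_mul_of_nonneg_left (h0 w) ht2.le
    rw [show α / t = 1 / t * α by ring]
    linarith) x
  simpa using this

lemma norm_sq_step_le {T : W →L[ℝ] W} {α t : ℝ} (hT : IsSelfAdjoint T) (hα0 : 0 < α)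
    (ht : 1 < t) (h0 : ∀ w, α * ‖w‖ ^ 2 ≤ ⟪T w, w⟫) (h1 : ∀ w, ⟪T w, w⟫ ≤ ‖w‖ ^ 2) (x y : W) :
    ‖x - (1 / t) • (T x + y)‖ ^ 2 ≤
      (1 - α / t) * ‖x‖ ^ 2 - 2 / t * ⟪x, y⟫ + ‖y‖ ^ 2 / (t * (t - 1)) := by
  have ht0 : 0 < t := by linarith
  have ht1 : 0 < t - 1 := by linarith
  have ha := norm_apply_sq_le_of_isSelfAdjoint hT one_pos
    (fun w => le_trans (by positivity) (h0 w)) (by simpa using h1) x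
  rw [one_mul] at ha
  have hyoung : ‖T x + y‖ ^ 2 ≤ t * ‖T x‖ ^ 2 + t / (t - 1) * ‖y‖ ^ 2 := by
    have hn := sq_nonneg ‖(t - 1) • T x - y‖
    rw [norm_sub_sq_real, norm_smul, mul_pow,
      real_inner_smul_left, Real.norm_eq_abs, sq_abs] at hn
    rw [norm_add_sq_real]
    have e : t / (t - 1) * ‖y‖ ^ 2 = ‖y‖ ^ 2 + ‖y‖ ^ 2 / (t - 1) := by field_simp; ring
    have hd : 0 ≤ (t - 1) * ‖T x‖ ^ 2 - 2 * ⟪T x, y⟫ + ‖y‖ ^ 2 / (t - 1) := by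
      have := div_nonneg hn ht1.le
      have e2 : ((t - 1) ^ 2 * ‖T x‖ ^ 2 - 2 * ((t - 1) * ⟪T x, y⟫) + ‖y‖ ^ 2) / (t - 1) =
        (t - 1) * ‖T x‖ ^ 2 - 2 * ⟪T x, y⟫ + ‖y‖ ^ 2 / (t - 1) := by field_simp
      rwa [e2] at this
    rw [e]; linarith
  rw [norm_sub_sq_real, norm_smul, mul_pow, real_inner_smul_right, inner_add_right,
    real_inner_comm, Real.norm_eq_abs, sq_abs]
  have i1 := mul_le_mul_of_nonneg_left hyoung (by positivity : 0 ≤ (1 / t) ^ 2)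
  have i2 := mul_le_mul_of_nonneg_left ha (by positivity : 0 ≤ 1 / t)
  have i3 := mul_le_mul_of_nonneg_left (h0 x) (by positivity : 0 ≤ 1 / t)
  have e1 : (1 / t) ^ 2 * (t * ‖T x‖ ^ 2 + t / (t - 1) * ‖y‖ ^ 2) =
    1 / t * ‖T x‖ ^ 2 + ‖y‖ ^ 2 / (t * (t - 1)) := by field_simp
  rw [e1] at i1
  have e2 : (1 - α / t) * ‖x‖ ^ 2 = ‖x‖ ^ 2 - 1 / t * (α * ‖x‖ ^ 2) := by ring
  have e3 : 2 / t * ⟪x, y⟫ = 2 * (1 / t * ⟪x, y⟫) := by ring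
  rw [e2, e3]
  linarith

end Operator

/-! ### Total variation -/

lemma abs_integral_sub_le_of_measure_sub_le {Z : Type*} [MeasurableSpace Z] {μ ν : Measure Z}
    [IsProbabilityMeasure μ] [IsProbabilityMeasure ν] {φ c : ℝ} (hc : 0 ≤ c)
    (h : ∀ B, MeasurableSet B → |μ.real B - ν.real B| ≤ φ) {g : Z → ℝ} (hg : Measurable g)
    (hgc : ∀ z, |g z| ≤ c) : |∫ z, g z ∂μ - ∫ z, g z ∂ν| ≤ 2 * c * φ := by
  have hg_int : ∀ (m : Measure Z) [IsProbabilityMeasure m], Integrable g m := fun m _ =>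
    Integrable.of_bound hg.aestronglyMeasurable c (ae_of_all _ hgc)
  have hlayer : ∀ (m : Measure Z) [IsProbabilityMeasure m], ∫ z, g z ∂m =
      (∫ t in Set.Ioc 0 (2 * c), m.real {a | t ≤ g a + c}) - c := by
    intro m _
    have hi : Integrable (fun z => g z + c) m := (hg_int m).add (integrable_const c)
    rw [← hi.integral_eq_integral_Ioc_meas_le
      (ae_of_all _ fun z => by have := (abs_le.1 (hgc z)).1; simp; linarith)
      (ae_of_all _ fun z => by have := (abs_le.1 (hgc z)).2; simp; linarith),
      integral_add (hg_int m) (integrable_const c)]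
    simp
  have hlayer_int : ∀ (m : Measure Z) [IsProbabilityMeasure m],
      IntegrableOn (fun t => m.real {a | t ≤ g a + c}) (Set.Ioc 0 (2 * c)) := by
    intro m _
    have hanti : Antitone (fun t : ℝ => m.real {a | t ≤ g a + c}) := fun s t hst =>
      measureReal_mono fun a ha => le_trans hst ha
    exact (hanti.antitoneOn _).integrableOn_isCompact isCompact_Icc |>.mono_set
      Set.Ioc_subset_Icc_self
  rw [hlayer μ, hlayer ν, sub_sub_sub_cancel_right, ← integral_sub (hlayer_int μ) (hlayer_int ν)]
  have := norm_setIntegral_le_of_norm_le_const (μ := volume) (s := Set.Ioc 0 (2 * c)) (C := φ)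
    (f := fun t => μ.real {a | t ≤ g a + c} - ν.real {a | t ≤ g a + c}) measure_Ioc_lt_top
    (fun t _ => h _ (measurableSet_le measurable_const (hg.add_const c)))
  rw [Real.norm_eq_abs] at this
  refine this.trans_eq ?_
  simp [Measure.real, hc]
  ring

section Mixing

variable {Z : Type*} [MeasurableSpace Z] {P : Kernel Z Z} [IsMarkovKernel P]
  {ρ : Measure Z} [IsProbabilityMeasure ρ]

instance isMarkovKernel_kernelIter (m : ℕ) : IsMarkovKernel (kernelIter P m) := by
  induction m with
  | zero => rw [kernelIter]; infer_instance
  | succ m ih => rw [kernelIter]; infer_instance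

lemma ae_kernelIter_sub_le {φ : ℝ} {m : ℕ} (h : phiCoef P ρ m ≤ φ) :
    ∀ᵐ z ∂ρ, ∀ B, MeasurableSet B → |(kernelIter P m z).real B - ρ.real B| ≤ φ := by
  have hle : ∀ z (B : Set Z), |(kernelIter P m z B).toReal - (ρ B).toReal| ≤ 1 := by
    intro z B
    have h1 : (kernelIter P m z).real B ≤ 1 := measureReal_le_one
    have h2 : ρ.real B ≤ 1 := measureReal_le_one
    have h3 : 0 ≤ (kernelIter P m z).real B := measureReal_nonneg
    have h4 : 0 ≤ ρ.real B := measureReal_nonneg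
    rw [Measure.real] at *
    rw [abs_le]
    constructor <;> linarith
  have hbdd : ∀ z, BddAbove (Set.range fun B : {B : Set Z // MeasurableSet B} =>
      |(kernelIter P m z B.1).toReal - (ρ B.1).toReal|) := fun z =>
    ⟨1, by rintro _ ⟨B, rfl⟩; exact hle z B.1⟩
  have := ae_le_essSup (μ := ρ) (f := fun z => ⨆ B : {B : Set Z // MeasurableSet B},
    |(kernelIter P m z B.1).toReal - (ρ B.1).toReal|)
    ⟨1, by
      rw [Filter.eventually_map]
      exact ae_of_all _ fun z => Real.iSup_le (fun B => hle z B.1) zero_le_one⟩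
  filter_upwards [this] with z hz B hB
  exact (le_ciSup (hbdd z) ⟨B, hB⟩).trans (hz.trans h)

variable {W : Type*} [NormedAddCommGroup W] [InnerProductSpace ℝ W] [CompleteSpace W]

lemma ae_norm_integral_kernelIter_le {φ τ : ℝ} {m : ℕ} (h : phiCoef P ρ m ≤ φ) (hτ : 0 ≤ τ)
    {y : Z → W} (hy : StronglyMeasurable y) (hyτ : ∀ z, ‖y z‖ ≤ τ) (hmean : ∫ z, y z ∂ρ = 0) :
    ∀ᵐ z ∂ρ, ‖∫ z', y z' ∂(kernelIter P m z)‖ ≤ 2 * τ * φ := by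
  filter_upwards [ae_kernelIter_sub_le h] with z hz
  have hg_int : ∀ (ν : Measure Z) [IsProbabilityMeasure ν], Integrable y ν := fun ν _ =>
    Integrable.of_bound hy.aestronglyMeasurable τ (ae_of_all _ hyτ)
  set g := ∫ z', y z' ∂(kernelIter P m z) with hg
  have hb := abs_integral_sub_le_of_measure_sub_le (μ := kernelIter P m z) (ν := ρ)
    (c := ‖g‖ * τ) (by positivity) hz (g := fun z' => ⟪g, y z'⟫)
    (stronglyMeasurable_const.inner hy).measurable
    (fun z' => (abs_real_inner_le_norm _ _).trans (by gcongr; exact hyτ z'))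
  rw [integral_inner (hg_int _), integral_inner (hg_int _), hmean, inner_zero_right, sub_zero, ← hg,
    real_inner_self_eq_norm_sq, abs_of_nonneg (sq_nonneg _)] at hb
  rcases (norm_nonneg g).eq_or_lt with h0 | h0
  · have hφ : 0 ≤ φ := (abs_nonneg _).trans (hz ∅ MeasurableSet.empty)
    rw [← h0]; positivity
  · nlinarith

end Mixing

/-! ### The trajectory measure -/

section Trajectory

variable {Z : Type*} [MeasurableSpace Z] {P : Kernel Z Z} [IsMarkovKernel P]
  {ρ : Measure Z} [IsProbabilityMeasure ρ]

lemma measurable_fin_snoc (n : ℕ) :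
    Measurable (fun p : (Fin n → Z) × Z => (Fin.snoc p.1 p.2 : Fin (n + 1) → Z)) := by
  refine measurable_pi_iff.2 fun i => ?_
  refine Fin.lastCases ?_ (fun i => ?_) i
  · simpa using measurable_snd
  · simpa using! (measurable_pi_apply i).comp measurable_fst

lemma measurable_fin_init (n : ℕ) :
    Measurable (fun v : Fin (n + 1) → Z => (Fin.init v : Fin n → Z)) :=
  measurable_pi_iff.2 fun _ => measurable_pi_apply _

instance isMarkovKernel_stepKernel (n : ℕ) : IsMarkovKernel (stepKernel P ρ n) := by
  cases n <;> (rw [stepKernel]; infer_instance)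

instance isProbabilityMeasure_trajMeasure (n : ℕ) : IsProbabilityMeasure (trajMeasure P ρ n) := by
  induction n with
  | zero => rw [trajMeasure]; infer_instance
  | succ n ih =>
    rw [trajMeasure]
    exact Measure.isProbabilityMeasure_map (measurable_fin_snoc n).aemeasurable

lemma map_init_trajMeasure (n : ℕ) :
    (trajMeasure P ρ (n + 1)).map Fin.init = trajMeasure P ρ n := by
  rw [trajMeasure, Measure.map_map (measurable_fin_init n) (measurable_fin_snoc n)]
  have : (Fin.init ∘ fun p : (Fin n → Z) × Z => (Fin.snoc p.1 p.2 : Fin (n + 1) → Z)) = Prod.fst := by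
    ext p i; simp
  rw [this]
  exact Measure.fst_compProd _ _

lemma map_last_trajMeasure (hinv : ρ.bind (fun z => P z) = ρ) (n : ℕ) :
    (trajMeasure P ρ (n + 1)).map (fun v => v (Fin.last n)) = ρ := by
  have hsnd : ∀ n, (trajMeasure P ρ (n + 1)).map (fun v => v (Fin.last n)) =
      (trajMeasure P ρ n).bind (stepKernel P ρ n) := by
    intro n
    rw [trajMeasure, Measure.map_map (measurable_pi_apply _) (measurable_fin_snoc n)]
    have : ((fun v : Fin (n + 1) → Z => v (Fin.last n)) ∘
        fun p : (Fin n → Z) × Z => (Fin.snoc p.1 p.2 : Fin (n + 1) → Z)) = Prod.snd := by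
      ext p; simp
    rw [this]
    exact Measure.snd_compProd _ _
  induction n with
  | zero =>
    rw [hsnd, stepKernel]
    simp
  | succ n ih =>
    rw [hsnd]
    conv_rhs => rw [← hinv]
    conv_rhs => rw [← ih]
    ext s hs
    rw [Measure.bind_apply hs (Kernel.aemeasurable _), Measure.bind_apply hs (Kernel.aemeasurable P),
      lintegral_map (P.measurable_coe hs) (measurable_pi_apply _)]
    rfl

variable {W : Type*} [NormedAddCommGroup W] [InnerProductSpace ℝ W] [CompleteSpace W]

lemma integral_inner_init_last {n : ℕ} {f : (Fin (n + 1) → Z) → W} {g : Z → W} {a b : ℝ}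
    (hf : StronglyMeasurable f) (hg : StronglyMeasurable g) (hfa : ∀ v, ‖f v‖ ≤ a)
    (hgb : ∀ z, ‖g z‖ ≤ b) :
    ∫ v, ⟪f (Fin.init v), g (v (Fin.last (n + 1)))⟫ ∂(trajMeasure P ρ (n + 2)) =
      ∫ v, ⟪f v, ∫ z, g z ∂(P (v (Fin.last n)))⟫ ∂(trajMeasure P ρ (n + 1)) := by
  have hm : StronglyMeasurable
      (fun v : Fin (n + 2) → Z => ⟪f (Fin.init v), g (v (Fin.last (n + 1)))⟫) :=
    (hf.comp_measurable (measurable_fin_init _)).inner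
      (hg.comp_measurable (measurable_pi_apply _))
  rw [trajMeasure, integral_map (measurable_fin_snoc _).aemeasurable hm.aestronglyMeasurable,
    Measure.integral_compProd]
  · refine integral_congr_ae (ae_of_all _ fun v => ?_)
    simp only [Fin.init_snoc, Fin.snoc_last]
    rw [integral_inner]
    · rfl
    · exact Integrable.of_bound hg.aestronglyMeasurable b (ae_of_all _ hgb)
  · refine Integrable.of_bound
      (hm.comp_measurable (measurable_fin_snoc _)).aestronglyMeasurable (a * b)
      (ae_of_all _ fun p => ?_)
    exact (norm_inner_le_norm _ _).trans
      (mul_le_mul (hfa _) (hgb _) (norm_nonneg _) ((norm_nonneg _).trans (hfa p.1)))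

end Trajectory

/-! ### The noise part of the iterates -/

lemma harmonic_add_one_le (n : ℕ) :
    (∑ k ∈ Finset.range n, 1 / ((k : ℝ) + 1)) + 1 ≤ 3 / 2 * √(n + 1) := by
  have h2 : (14 : ℝ) / 10 ≤ √2 := Real.le_sqrt_of_sq_le (by norm_num)
  have h3 : (17 : ℝ) / 10 ≤ √3 := Real.le_sqrt_of_sq_le (by norm_num)
  rcases n with _ | _ | n
  · norm_num
  · norm_num; linarith
  · induction n with
    | zero => norm_num [Finset.sum_range_succ]; linarith
    | succ n ih =>
      rw [Finset.sum_range_succ]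
      push_cast at ih ⊢
      rw [show (n : ℝ) + 1 + 1 + 1 = n + 3 by ring] at *
      rw [show (n : ℝ) + 3 + 1 = n + 4 by ring]
      have hn : (0 : ℝ) ≤ n := n.cast_nonneg
      have ha : 0 ≤ √((n : ℝ) + 3) := Real.sqrt_nonneg _
      have hb : 0 ≤ √((n : ℝ) + 4) := Real.sqrt_nonneg _
      have ha2 := Real.sq_sqrt (by linarith : (0 : ℝ) ≤ n + 3)
      have hb2 := Real.sq_sqrt (by linarith : (0 : ℝ) ≤ n + 4)
      set a := √((n : ℝ) + 3)
      set b := √((n : ℝ) + 4)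
      have hsum : a + b ≤ 3 / 2 * (n + 3) := by
        nlinarith [sq_nonneg (a - 2), sq_nonneg (b - 2)]
      have hab : 0 < a + b := by nlinarith
      have hdiff : b - a = 1 / (a + b) := by
        rw [eq_div_iff hab.ne']; nlinarith
      have : 1 / ((n : ℝ) + 3) ≤ 3 / 2 * (b - a) := by
        rw [hdiff, ← mul_div_assoc, mul_one, div_le_div_iff₀ (by linarith) hab]; linarith
      refine le_trans (le_of_eq ?_) ((add_le_add ih this).trans (by linarith))
      ring_nf

section Noise

variable {Z : Type*} {W : Type*} [NormedAddCommGroup W] [InnerProductSpace ℝ W]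

/-- The iteration `x ↦ x - (T z x + y z) / s` started at `0`, along a trajectory. -/
noncomputable def noisePart (T : Z → W →L[ℝ] W) (y : Z → W) : (n : ℕ) → (Fin n → Z) → W
  | 0, _ => 0
  | n + 1, v => noisePart T y n (Fin.init v) - (1 / ((n : ℝ) + 1)) •
      (T (v (Fin.last n)) (noisePart T y n (Fin.init v)) + y (v (Fin.last n)))

section Measurability

variable [MeasurableSpace Z]

/-- Evaluating a pointwise strongly measurable operator field along a strongly measurable map is
strongly measurable; no separability of `W` is needed. -/
lemma stronglyMeasurable_clm_apply {Ω : Type*} [MeasurableSpace Ω] {T : Z → W →L[ℝ] W}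
    (hT : ∀ w, StronglyMeasurable fun z => T z w) {ζ : Ω → Z} (hζ : Measurable ζ) {f : Ω → W}
    (hf : StronglyMeasurable f) : StronglyMeasurable fun ω => T (ζ ω) (f ω) := by
  refine stronglyMeasurable_of_tendsto Filter.atTop
    (f := fun n ω => T (ζ ω) (hf.approx n ω)) (fun n => ?_) ?_
  · have e : (fun ω => T (ζ ω) (hf.approx n ω)) = fun ω => ∑ c ∈ (hf.approx n).range,
        Set.indicator (hf.approx n ⁻¹' {c}) (fun ω => T (ζ ω) c) ω := by
      ext ω
      rw [Finset.sum_eq_single (hf.approx n ω)]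
      · simp
      · intro c _ hc
        exact Set.indicator_of_notMem (fun h => hc (by simpa using h.symm)) _
      · intro h
        exact absurd (SimpleFunc.mem_range_self _ ω) h
    rw [e]
    exact Finset.stronglyMeasurable_fun_sum _ fun c _ =>
      ((hT c).comp_measurable hζ).indicator ((hf.approx n).measurableSet_preimage _)
  · rw [tendsto_pi_nhds]
    exact fun ω => ((T (ζ ω)).continuous.tendsto _).comp (hf.tendsto_approx ω)

lemma stronglyMeasurable_noisePart {T : Z → W →L[ℝ] W} {y : Z → W}
    (hT : ∀ w, StronglyMeasurable fun z => T z w)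
    (hy : StronglyMeasurable y) (n : ℕ) : StronglyMeasurable (noisePart T y n) := by
  induction n with
  | zero => exact stronglyMeasurable_const
  | succ n ih =>
    have hi := ih.comp_measurable (measurable_fin_init n)
    exact hi.sub (((stronglyMeasurable_clm_apply hT (measurable_pi_apply _) hi).add
      (hy.comp_measurable (measurable_pi_apply _))).const_smul _)

end Measurability

variable {T : Z → W →L[ℝ] W} {y : Z → W} [CompleteSpace W] {α τ : ℝ}

/-- The deterministic contraction of the initial error. -/
lemma norm_sub_noisePart_le (hα0 : 0 < α) (hα1 : α < 1 / 2)
    (hT_sa : ∀ z, IsSelfAdjoint (T z)) (hlb : ∀ z, ∀ w : W, α * ‖w‖ ^ 2 ≤ ⟪T z w, w⟫)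
    (hub : ∀ z, ∀ w : W, ⟪T z w, w⟫ ≤ ‖w‖ ^ 2)
    (n : ℕ) (v : Fin n → Z) (e : ℕ → W)
    (he : ∀ s : Fin n, e (s.1 + 1) = e s.1 - (1 / ((s.1 : ℝ) + 1)) • (T (v s) (e s.1) + y (v s))) :
    ‖e n - noisePart T y n v‖ ≤ (1 / ((n : ℝ) + 1)) ^ α * ‖e 0‖ := by
  induction n with
  | zero => simp [noisePart]
  | succ n ih =>
    have h := ih (Fin.init v) fun s => he s.castSucc
    have hl := he (Fin.last n)
    simp only [Fin.val_last] at hl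
    rw [hl, noisePart]
    set x := noisePart T y n (Fin.init v)
    have e1 : e n - (1 / ((n : ℝ) + 1)) • (T (v (Fin.last n)) (e n) + y (v (Fin.last n))) -
        (x - (1 / ((n : ℝ) + 1)) • (T (v (Fin.last n)) x + y (v (Fin.last n)))) =
        (e n - x) - (1 / ((n : ℝ) + 1)) • T (v (Fin.last n)) (e n - x) := by
      rw [map_sub]
      module
    rw [e1]
    have hn : (1 : ℝ) ≤ n + 1 := by linarith [n.cast_nonneg (α := ℝ)]
    refine (norm_sub_smul_apply_le (hT_sa _) (by linarith) hα0 hn (hlb _) (hub _) _).trans ?_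
    have hc := one_sub_div_mul_rpow_le hα0.le (by linarith : α ≤ 1) hn
    have hnn : 0 ≤ 1 - α / ((n : ℝ) + 1) := by
      have : α / ((n : ℝ) + 1) ≤ 1 := by rw [div_le_one (by positivity)]; linarith
      linarith
    refine (mul_le_mul_of_nonneg_left h hnn).trans ?_
    rw [← mul_assoc]
    gcongr
    push_cast
    rw [Real.div_rpow (by positivity) (by positivity), Real.div_rpow (by positivity) (by positivity),
      Real.one_rpow, ← mul_div_assoc, mul_one, div_le_div_iff₀ (by positivity) (by positivity)]
    linarith

lemma norm_noisePart_le (hα0 : 0 < α) (hα1 : α < 1 / 2)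
    (hT_sa : ∀ z, IsSelfAdjoint (T z)) (hlb : ∀ z, ∀ w : W, α * ‖w‖ ^ 2 ≤ ⟪T z w, w⟫)
    (hub : ∀ z, ∀ w : W, ⟪T z w, w⟫ ≤ ‖w‖ ^ 2) (hyτ : ∀ z, ‖y z‖ ≤ τ)
    (n : ℕ) (v : Fin n → Z) :
    ‖noisePart T y n v‖ ≤ τ * ∑ k ∈ Finset.range n, 1 / ((k : ℝ) + 1) := by
  induction n with
  | zero => simp [noisePart]
  | succ n ih =>
    rw [noisePart, Finset.sum_range_succ, smul_add, ← sub_sub, mul_add]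
    have h1 := norm_sub_smul_apply_le (hT_sa (v (Fin.last n))) (by linarith) hα0
      (by linarith [n.cast_nonneg (α := ℝ)] : (1 : ℝ) ≤ n + 1) (hlb _) (hub _)
      (noisePart T y n (Fin.init v))
    have h2 : ‖(1 / ((n : ℝ) + 1)) • y (v (Fin.last n))‖ ≤ τ * (1 / ((n : ℝ) + 1)) := by
      rw [norm_smul, Real.norm_of_nonneg (by positivity), mul_comm]
      gcongr
      exact hyτ _
    have h3 : (1 - α / ((n : ℝ) + 1)) * ‖noisePart T y n (Fin.init v)‖ ≤
        ‖noisePart T y n (Fin.init v)‖ := by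
      refine mul_le_of_le_one_left (norm_nonneg _) ?_
      have : 0 ≤ α / ((n : ℝ) + 1) := by positivity
      linarith
    exact (norm_sub_le _ _).trans (add_le_add (h1.trans (h3.trans (ih _))) h2)

lemma norm_noisePart_succ_sub_le (hα0 : 0 < α) (hα1 : α < 1 / 2)
    (hT_sa : ∀ z, IsSelfAdjoint (T z)) (hlb : ∀ z, ∀ w : W, α * ‖w‖ ^ 2 ≤ ⟪T z w, w⟫)
    (hub : ∀ z, ∀ w : W, ⟪T z w, w⟫ ≤ ‖w‖ ^ 2) (hyτ : ∀ z, ‖y z‖ ≤ τ)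
    (hτ : 0 ≤ τ) (n : ℕ) (v : Fin (n + 1) → Z) :
    ‖noisePart T y (n + 1) v - noisePart T y n (Fin.init v)‖ ≤ 3 / 2 * τ * (1 / √(n + 1)) := by
  rw [noisePart, sub_sub_cancel_left, norm_neg, norm_smul, Real.norm_of_nonneg (by positivity)]
  have h1 := norm_apply_le_of_isSelfAdjoint (hT_sa (v (Fin.last n))) one_pos
    (fun w => le_trans (by positivity) (hlb _ w)) (by simpa using hub _)
    (noisePart T y n (Fin.init v))
  have h2 := norm_noisePart_le hα0 hα1 hT_sa hlb hub hyτ n (Fin.init v)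
  have h3 := mul_le_mul_of_nonneg_left (harmonic_add_one_le n) hτ
  have h4 : ‖T (v (Fin.last n)) (noisePart T y n (Fin.init v)) + y (v (Fin.last n))‖ ≤
      τ * (3 / 2 * √(n + 1)) :=
    (norm_add_le _ _).trans (by linarith [hyτ (v (Fin.last n))])
  have hs : √((n : ℝ) + 1) ^ 2 = n + 1 := Real.sq_sqrt (by positivity)
  have hpos : 0 < √((n : ℝ) + 1) := Real.sqrt_pos.2 (by positivity)
  calc _ ≤ 1 / ((n : ℝ) + 1) * (τ * (3 / 2 * √(n + 1))) := by gcongr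
    _ = _ := by
      rw [← hs, Real.sqrt_sq hpos.le]
      field_simp

variable [MeasurableSpace Z] {P : Kernel Z Z} [IsMarkovKernel P]
  {ρ : Measure Z} [IsProbabilityMeasure ρ]

lemma abs_integral_inner_noisePart_le (hα0 : 0 < α) (hα1 : α < 1 / 2)
    (hT_sa : ∀ z, IsSelfAdjoint (T z)) (hlb : ∀ z, ∀ w : W, α * ‖w‖ ^ 2 ≤ ⟪T z w, w⟫)
    (hub : ∀ z, ∀ w : W, ⟪T z w, w⟫ ≤ ‖w‖ ^ 2) (hyτ : ∀ z, ‖y z‖ ≤ τ)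
    (hτ : 0 ≤ τ) (hT : ∀ w, StronglyMeasurable fun z => T z w)
    (hy : StronglyMeasurable y) (hinv : ρ.bind (fun z => P z) = ρ) (hmean : ∫ z, y z ∂ρ = 0)
    {D r : ℝ} (hphi : ∀ m : ℕ, 1 ≤ m → phiCoef P ρ m ≤ D * r ^ m) (n m : ℕ) :
    |∫ v, ⟪noisePart T y (n + 1) v, ∫ z, y z ∂(kernelIter P (m + 1) (v (Fin.last n)))⟫
      ∂(trajMeasure P ρ (n + 1))| ≤ 3 * τ ^ 2 * D * r ^ m * mixConv r (n + 1) := by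
  have hgm : ∀ m, StronglyMeasurable fun z => ∫ z', y z' ∂(kernelIter P m z) := fun m =>
    hy.integral_kernel
  have hgb : ∀ m z, ‖∫ z', y z' ∂(kernelIter P m z)‖ ≤ τ := fun m z => by
    simpa using norm_integral_le_of_norm_le_const (μ := kernelIter P m z) (ae_of_all _ hyτ)
  have hx := stronglyMeasurable_noisePart hT hy
  have hxb := norm_noisePart_le hα0 hα1 hT_sa hlb hub hyτ
  have hincr : ∀ n m : ℕ, |∫ v, ⟪noisePart T y (n + 1) v - noisePart T y n (Fin.init v),
      ∫ z, y z ∂(kernelIter P (m + 1) (v (Fin.last n)))⟫ ∂(trajMeasure P ρ (n + 1))| ≤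
      3 * τ ^ 2 * D * r ^ (m + 1) * (1 / √(n + 1)) := by
    intro n m
    have hae : ∀ᵐ v ∂(trajMeasure P ρ (n + 1)),
        ‖∫ z, y z ∂(kernelIter P (m + 1) (v (Fin.last n)))‖ ≤ 2 * τ * (D * r ^ (m + 1)) := by
      have := ae_norm_integral_kernelIter_le (hphi (m + 1) (by omega)) hτ hy hyτ hmean
      rw [← map_last_trajMeasure hinv n] at this
      exact ae_of_ae_map (measurable_pi_apply _).aemeasurable this
    have := norm_integral_le_of_norm_le_const (μ := trajMeasure P ρ (n + 1))
      (f := fun v => ⟪noisePart T y (n + 1) v - noisePart T y n (Fin.init v),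
        ∫ z, y z ∂(kernelIter P (m + 1) (v (Fin.last n)))⟫)
      (C := 3 / 2 * τ * (1 / √(n + 1)) * (2 * τ * (D * r ^ (m + 1)))) (by
        filter_upwards [hae] with v hv
        exact (norm_inner_le_norm _ _).trans (mul_le_mul
          (norm_noisePart_succ_sub_le hα0 hα1 hT_sa hlb hub hyτ hτ n v) hv (norm_nonneg _)
          (by positivity)))
    rw [Real.norm_eq_abs, probReal_univ, mul_one] at this
    exact this.trans_eq (by ring)
  induction n generalizing m with
  | zero =>
    have h := hincr 0 m
    have e : ∀ v : Fin 1 → Z, noisePart T y 0 (Fin.init v) = 0 := fun _ => rfl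
    simp only [e, sub_zero] at h
    refine h.trans_eq ?_
    simp [mixConv]
    ring
  | succ n ih =>
    have hsplit : ∫ v, ⟪noisePart T y (n + 2) v,
          ∫ z, y z ∂(kernelIter P (m + 1) (v (Fin.last (n + 1))))⟫ ∂(trajMeasure P ρ (n + 2)) =
        ∫ v, ⟪noisePart T y (n + 2) v - noisePart T y (n + 1) (Fin.init v),
          ∫ z, y z ∂(kernelIter P (m + 1) (v (Fin.last (n + 1))))⟫ ∂(trajMeasure P ρ (n + 2)) +
        ∫ v, ⟪noisePart T y (n + 1) v,
          ∫ z, y z ∂(kernelIter P (m + 2) (v (Fin.last n)))⟫ ∂(trajMeasure P ρ (n + 1)) := by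
      have hk : ∀ z, ∫ z', y z' ∂(kernelIter P (m + 2) z) =
          ∫ z', ∫ z'', y z'' ∂(kernelIter P (m + 1) z') ∂(P z) := fun z => by
        rw [kernelIter, Kernel.integral_comp]
        exact Integrable.of_bound hy.aestronglyMeasurable τ (ae_of_all _ hyτ)
      simp only [hk]
      rw [← integral_inner_init_last (hx (n + 1)) (hgm (m + 1)) (hxb (n + 1)) (hgb (m + 1)),
        ← integral_add]
      · simp [inner_sub_left]
      · refine Integrable.of_bound (((hx (n + 2)).sub ((hx (n + 1)).comp_measurable
          (measurable_fin_init _))).inner ((hgm (m + 1)).comp_measurable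
          (measurable_pi_apply _))).aestronglyMeasurable
          (3 / 2 * τ * (1 / √((n + 1 : ℕ) + 1)) * τ) (ae_of_all _ fun v => ?_)
        exact (norm_inner_le_norm _ _).trans (mul_le_mul
          (norm_noisePart_succ_sub_le hα0 hα1 hT_sa hlb hub hyτ hτ (n + 1) v) (hgb _ _)
          (norm_nonneg _) (by positivity))
      · refine Integrable.of_bound ((((hx (n + 1)).comp_measurable
          (measurable_fin_init _))).inner ((hgm (m + 1)).comp_measurable
          (measurable_pi_apply _))).aestronglyMeasurable
          ((τ * ∑ k ∈ Finset.range (n + 1), 1 / ((k : ℝ) + 1)) * τ) (ae_of_all _ fun v => ?_)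
        exact (norm_inner_le_norm _ _).trans (mul_le_mul
          (hxb (n + 1) _) (hgb _ _) (norm_nonneg _) (by positivity))
    rw [hsplit]
    refine (abs_add_le _ _).trans ((add_le_add (hincr (n + 1) m) (ih (m + 1))).trans_eq ?_)
    rw [mixConv.eq_2 r (n + 1)]
    push_cast
    ring

lemma integrable_norm_sq_noisePart (hα0 : 0 < α) (hα1 : α < 1 / 2)
    (hT_sa : ∀ z, IsSelfAdjoint (T z)) (hlb : ∀ z, ∀ w : W, α * ‖w‖ ^ 2 ≤ ⟪T z w, w⟫)
    (hub : ∀ z, ∀ w : W, ⟪T z w, w⟫ ≤ ‖w‖ ^ 2) (hyτ : ∀ z, ‖y z‖ ≤ τ)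
    (hT : ∀ w, StronglyMeasurable fun z => T z w)
    (hy : StronglyMeasurable y) (n : ℕ) :
    Integrable (fun v => ‖noisePart T y n v‖ ^ 2) (trajMeasure P ρ n) :=
  Integrable.of_bound ((stronglyMeasurable_noisePart hT hy n).norm.pow 2).aestronglyMeasurable
    ((τ * ∑ k ∈ Finset.range n, 1 / ((k : ℝ) + 1)) ^ 2) (ae_of_all _ fun v => by
      rw [Real.norm_of_nonneg (by positivity)]
      gcongr
      exact norm_noisePart_le hα0 hα1 hT_sa hlb hub hyτ n v)

lemma integral_norm_sq_noisePart_le (hα0 : 0 < α) (hα1 : α < 1 / 2)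
    (hT_sa : ∀ z, IsSelfAdjoint (T z)) (hlb : ∀ z, ∀ w : W, α * ‖w‖ ^ 2 ≤ ⟪T z w, w⟫)
    (hub : ∀ z, ∀ w : W, ⟪T z w, w⟫ ≤ ‖w‖ ^ 2) (hyτ : ∀ z, ‖y z‖ ≤ τ)
    (hτ : 0 ≤ τ) (hT : ∀ w, StronglyMeasurable fun z => T z w)
    (hy : StronglyMeasurable y) (hinv : ρ.bind (fun z => P z) = ρ) (hmean : ∫ z, y z ∂ρ = 0)
    {D r : ℝ} (hD : 0 ≤ D) (hr0 : 0 ≤ r) (hr1 : r < 1)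
    (hphi : ∀ m : ℕ, 1 ≤ m → phiCoef P ρ m ≤ D * r ^ m) (n : ℕ) (hn : 1 ≤ n) :
    ((n : ℝ) + 1) ^ α * ∫ v, ‖noisePart T y n v‖ ^ 2 ∂(trajMeasure P ρ n) ≤
      4 * τ ^ 2 * (1 / (1 - 2 * α)) * (1 + 6 * D * r / (1 - r)) := by
  have hx := stronglyMeasurable_noisePart hT hy
  have hxb := norm_noisePart_le hα0 hα1 hT_sa hlb hub hyτ
  have hsq_int : ∀ n, Integrable (fun v => ‖noisePart T y n v‖ ^ 2) (trajMeasure P ρ n) :=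
    integrable_norm_sq_noisePart hα0 hα1 hT_sa hlb hub hyτ hT hy
  refine weighted_recursion_le hα0.le hα1 hr0 hr1 hD
    (fun n => ∫ v, ‖noisePart T y n v‖ ^ 2 ∂(trajMeasure P ρ n))
    (fun n => integral_nonneg fun v => by positivity) ?_ (fun n hn => ?_) n hn
  · have := norm_integral_le_of_norm_le_const (μ := trajMeasure P ρ 1)
      (f := fun v => ‖noisePart T y 1 v‖ ^ 2) (C := τ ^ 2) (ae_of_all _ fun v => by
        rw [Real.norm_of_nonneg (by positivity)]
        gcongr
        simpa using hxb 1 v)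
    rw [probReal_univ, mul_one] at this
    exact (le_abs_self _).trans this
  · obtain ⟨n, rfl⟩ : ∃ k, n = k + 1 := ⟨n - 1, by omega⟩
    have hcross := abs_integral_inner_noisePart_le hα0 hα1 hT_sa hlb hub hyτ hτ hT hy hinv hmean
      hphi n 0
    have hk : ∀ z, ∫ z', y z' ∂(kernelIter P (0 + 1) z) = ∫ z', y z' ∂(P z) := fun z => by
      rw [kernelIter, kernelIter, Kernel.id_comp]
    simp only [hk, pow_zero, mul_one] at hcross
    rw [← integral_inner_init_last (hx (n + 1)) hy (hxb (n + 1)) hyτ] at hcross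
    have hinit : ∫ v, ‖noisePart T y (n + 1) (Fin.init v)‖ ^ 2 ∂(trajMeasure P ρ (n + 2)) =
        ∫ v, ‖noisePart T y (n + 1) v‖ ^ 2 ∂(trajMeasure P ρ (n + 1)) := by
      rw [← map_init_trajMeasure (n + 1)]
      exact (integral_map (measurable_fin_init _).aemeasurable
        ((hx (n + 1)).norm.pow 2).aestronglyMeasurable).symm
    have hinit_int : Integrable (fun v => ‖noisePart T y (n + 1) (Fin.init v)‖ ^ 2)
        (trajMeasure P ρ (n + 2)) := by
      have := hsq_int (n + 1)
      rw [← map_init_trajMeasure (n + 1)] at this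
      exact this.comp_measurable (measurable_fin_init _)
    have hcross_int : Integrable
        (fun v => ⟪noisePart T y (n + 1) (Fin.init v), y (v (Fin.last (n + 1)))⟫)
        (trajMeasure P ρ (n + 2)) := by
      refine Integrable.of_bound ((((hx (n + 1)).comp_measurable
        (measurable_fin_init _))).inner (hy.comp_measurable
        (measurable_pi_apply _))).aestronglyMeasurable
        ((τ * ∑ k ∈ Finset.range (n + 1), 1 / ((k : ℝ) + 1)) * τ) (ae_of_all _ fun v => ?_)
      exact (norm_inner_le_norm _ _).trans (mul_le_mul
        (hxb (n + 1) _) (hyτ _) (norm_nonneg _) (by positivity))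
    have hpt : ∀ v : Fin (n + 2) → Z, ‖noisePart T y (n + 2) v‖ ^ 2 ≤
        (1 - α / ((n + 1 : ℕ) + 1)) * ‖noisePart T y (n + 1) (Fin.init v)‖ ^ 2
        - 2 / ((n + 1 : ℕ) + 1) * ⟪noisePart T y (n + 1) (Fin.init v), y (v (Fin.last (n + 1)))⟫
        + τ ^ 2 / (((n + 1 : ℕ) + 1) * (n + 1 : ℕ)) := fun v => by
      rw [noisePart.eq_2 T y (n + 1)]
      refine (norm_sq_step_le (hT_sa (v (Fin.last (n + 1)))) hα0 ?_ (hlb _) (hub _) _ _).trans ?_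
      · push_cast
        linarith [n.cast_nonneg (α := ℝ)]
      rw [add_sub_cancel_right]
      gcongr
      exact hyτ _
    have hmono := integral_mono (hsq_int (n + 2)) (((hinit_int.const_mul _).sub
      (hcross_int.const_mul _)).add (integrable_const _)) hpt
    rw [integral_add' ((hinit_int.const_mul _).sub (hcross_int.const_mul _)) (integrable_const _),
      integral_sub' (hinit_int.const_mul _) (hcross_int.const_mul _), integral_const_mul,
      integral_const_mul, integral_const, probReal_univ, one_smul, hinit] at hmono
    have hneg := mul_le_mul_of_nonneg_left ((neg_le_abs _).trans hcross)
      (by positivity : 0 ≤ 2 / (((n + 1 : ℕ) : ℝ) + 1))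
    refine hmono.trans ?_
    linarith

end Noise

/-- SS-MGD under exponentially fast φ-mixing, for step sizes `γ_s = 1/(η s)` (i.e. `θ = 1`)
and `α = κ/η ∈ (0, 1/2)`: with probability at least `1 - δ` over trajectories of length
`t - 1 = n`, `‖w_t − w*‖ ≤ (1/t)^α·‖w_1 − w*‖
  + √((4σ²/(δ η²))·(1/(1−2α))·(1/t)^α·(1 + 6Dr/(1−r)))`, with `t = n + 1`. -/
theorem ssmgd_phi_mixing_bound_theta_one
    {Z : Type*} [MeasurableSpace Z]
    {W : Type*} [NormedAddCommGroup W] [InnerProductSpace ℝ W] [CompleteSpace W]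
    (P : Kernel Z Z) [IsMarkovKernel P]
    (ρ : Measure Z) [IsProbabilityMeasure ρ]
    (hinv : ρ.bind (fun z => P z) = ρ)
    (A : Z → W →L[ℝ] W) (B : Z → W)
    (hA_sa : ∀ z, IsSelfAdjoint (A z))
    (hA_meas : ∀ w : W, StronglyMeasurable (fun z => A z w))
    (hB_meas : StronglyMeasurable B)
    (hA_int : ∀ w : W, Integrable (fun z => A z w) ρ)
    (hB_int : Integrable B ρ)
    (κ η : ℝ) (hκ : 0 < κ) (hκη : κ ≤ η) (hα : κ / η < 1/2)
    (hlb : ∀ z, ∀ w : W, κ * ‖w‖ ^ 2 ≤ ⟪A z w, w⟫)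
    (hub : ∀ z, ∀ w : W, ⟪A z w, w⟫ ≤ η * ‖w‖ ^ 2)
    (wstar : W) (σ : ℝ) (hσ : 0 ≤ σ)
    (hmean : ∫ z, (A z wstar + B z) ∂ρ = 0)
    (hbd : ∀ z, ‖A z wstar + B z‖ ≤ σ)
    (D r : ℝ) (hD : 0 < D) (hr0 : 0 < r) (hr1 : r < 1)
    (hphi : ∀ m : ℕ, 1 ≤ m → phiCoef P ρ m ≤ D * r ^ m)
    (w1 : W) (δ : ℝ) (hδ : δ ∈ Set.Ioo (0 : ℝ) 1)
    (n : ℕ) (hn : 1 ≤ n) :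
    ENNReal.ofReal (1 - δ) ≤
      trajMeasure P ρ n {z : Fin n → Z |
        ∀ w : ℕ → W, w 1 = w1 →
          (∀ s : Fin n, w (s.1 + 2) =
            w (s.1 + 1) - (1 / (η * ((s.1 + 1 : ℕ) : ℝ))) •
              (A (z s) (w (s.1 + 1)) + B (z s))) →
          ‖w (n + 1) - wstar‖ ≤
            (1 / ((n + 1 : ℕ) : ℝ)) ^ (κ / η) * ‖w1 - wstar‖ +
            Real.sqrt (4 * σ ^ 2 / (δ * η ^ 2) * (1 / (1 - 2 * (κ / η))) *
              (1 / ((n + 1 : ℕ) : ℝ)) ^ (κ / η) * (1 + 6 * D * r / (1 - r)))} := by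
  have hη : 0 < η := hκ.trans_le hκη
  have hα0 : 0 < κ / η := by positivity
  set α := κ / η with hαdef
  set T : Z → W →L[ℝ] W := fun z => η⁻¹ • A z with hTdef
  set y : Z → W := fun z => η⁻¹ • (A z wstar + B z) with hydef
  have hT_sa : ∀ z, IsSelfAdjoint (T z) := fun z =>
    IsSelfAdjoint.smul (by simp [IsSelfAdjoint]) (hA_sa z)
  have hT_inner : ∀ z w, ⟪T z w, w⟫ = η⁻¹ * ⟪A z w, w⟫ := fun z w => by
    simp [hTdef, real_inner_smul_left]
  have hT_lb : ∀ z, ∀ w : W, α * ‖w‖ ^ 2 ≤ ⟪T z w, w⟫ := fun z w => by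
    rw [hT_inner, hαdef, div_eq_inv_mul, mul_assoc]
    gcongr
    exact hlb z w
  have hT_ub : ∀ z, ∀ w : W, ⟪T z w, w⟫ ≤ ‖w‖ ^ 2 := fun z w => by
    rw [hT_inner, inv_mul_le_iff₀ hη]
    exact hub z w
  have hyτ : ∀ z, ‖y z‖ ≤ σ / η := fun z => by
    rw [hydef, norm_smul, Real.norm_of_nonneg (by positivity), div_eq_inv_mul]
    gcongr
    exact hbd z
  have hT_meas : ∀ w, StronglyMeasurable fun z => T z w := fun w => (hA_meas w).const_smul _
  have hy_meas : StronglyMeasurable y := ((hA_meas wstar).add hB_meas).const_smul _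
  have hy_mean : ∫ z, y z ∂ρ = 0 := by rw [integral_smul, hmean, smul_zero]
  have hd : 0 < 1 - 2 * α := by linarith
  have hr : 0 < 1 - r := by linarith
  have hδ0 : 0 < δ := hδ.1
  set R := 4 * σ ^ 2 / (δ * η ^ 2) * (1 / (1 - 2 * α)) *
    (1 / ((n + 1 : ℕ) : ℝ)) ^ α * (1 + 6 * D * r / (1 - r)) with hR
  have hx := stronglyMeasurable_noisePart hT_meas hy_meas n
  set G : Set (Fin n → Z) := {v | ‖noisePart T y n v‖ ≤ √R}
  have hG : MeasurableSet G := measurableSet_le hx.norm.measurable measurable_const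
  have hmoment : ∫ v, ‖noisePart T y n v‖ ^ 2 ∂(trajMeasure P ρ n) ≤ δ * R := by
    have h := integral_norm_sq_noisePart_le hα0 hα hT_sa hT_lb hT_ub hyτ (by positivity) hT_meas
      hy_meas hinv hy_mean hD.le hr0.le hr1 hphi n hn
    rw [← le_div_iff₀' (by positivity)] at h
    refine h.trans_eq ?_
    rw [hR, Real.div_rpow zero_le_one (by positivity), Real.one_rpow]
    push_cast
    field_simp
  have hbad : (trajMeasure P ρ n).real Gᶜ ≤ δ := by
    rcases hσ.eq_or_lt with h0 | h0
    · have : Gᶜ = ∅ := by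
        rw [Set.compl_empty_iff, Set.eq_univ_iff_forall]
        intro v
        have := norm_noisePart_le hα0 hα hT_sa hT_lb hT_ub hyτ n v
        rw [← h0, zero_div, zero_mul] at this
        exact this.trans (Real.sqrt_nonneg _)
      rw [this, measureReal_empty]
      exact hδ0.le
    · have hRpos : 0 < R := by positivity
      have hg_int : Integrable (fun v => ‖noisePart T y n v‖ ^ 2) (trajMeasure P ρ n) :=
        integrable_norm_sq_noisePart hα0 hα hT_sa hT_lb hT_ub hyτ hT_meas hy_meas n
      have hmk := mul_meas_ge_le_integral_of_nonneg (ae_of_all _ fun v => by positivity) hg_int R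
      have hsub : (trajMeasure P ρ n).real Gᶜ ≤
          (trajMeasure P ρ n).real {v | R ≤ ‖noisePart T y n v‖ ^ 2} :=
        measureReal_mono fun v hv => by
          have hlt : √R < ‖noisePart T y n v‖ := not_le.1 hv
          exact (Real.sqrt_le_left (norm_nonneg _)).1 hlt.le
      have := hmk.trans hmoment
      rw [mul_comm δ] at this
      exact hsub.trans (le_of_mul_le_mul_left this hRpos)
  have hgood : ENNReal.ofReal (1 - δ) ≤ trajMeasure P ρ n G := by
    apply ENNReal.ofReal_le_of_le_toReal
    have := probReal_compl_eq_one_sub (μ := trajMeasure P ρ n) hG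
    change 1 - δ ≤ (trajMeasure P ρ n).real G
    linarith
  refine hgood.trans (measure_mono fun v hv w hw1 hw => ?_)
  have hinit := norm_sub_noisePart_le (y := y) hα0 hα hT_sa hT_lb hT_ub n v
    (fun k => w (k + 1) - wstar) fun s => by
      rw [hw s, hTdef, hydef, map_sub]
      simp only [smul_apply]
      rw [sub_right_comm, sub_right_inj, one_div, mul_inv, mul_comm, mul_smul, one_div]
      push_cast
      congr 1
      module
  rw [zero_add, hw1] at hinit
  have htri := norm_add_le (w (n + 1) - wstar - noisePart T y n v) (noisePart T y n v)
  rw [sub_add_cancel] at htri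
  push_cast at hv ⊢
  exact htri.trans (add_le_add hinit (by simpa [G] using hv))
end

section
/- Let θ ∈ (1/2, 1) and α ∈ (0, 1]. Suppose the φ-mixing coefficients of the stationary Markov chain satisfy φ_m ≤ D r^m for all m ≥ 1, for some constants D > 0 and 0 < r < 1. Then for every t ≥ 1, 2·Σ_{1 ≤ i < j ≤ t} (1/i^θ)(1/j^θ) · Π_{k=i+1}^{t}(1 − α/k^θ) · Π_{l=j+1}^{t}(1 − α/l^θ) · ∫_Z ∫_Z ⟨f(z), f(z')⟩ P^{j−i}(z, dz') dρ(z) ≤ 4σ² · (Dr/(1−r)) · C_θ · (1/α)^{θ/(1−θ)} · (1/(t+1))^θ. -/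
open MeasureTheory ProbabilityTheory
open scoped ENNReal RealInnerProductSpace

section RealSums

open Finset

theorem sub_rpow_le_mul_sum_Ioc {θ : ℝ} (h0 : 0 < θ) (h1 : θ < 1) {k n : ℕ} (hkn : k ≤ n) :
    ((n : ℝ) + 1) ^ (1 - θ) - ((k : ℝ) + 1) ^ (1 - θ) ≤
      (1 - θ) * ∑ l ∈ Ioc k n, 1 / (l : ℝ) ^ θ := by
  induction n, hkn using Nat.le_induction with
  | base => simp
  | succ n hkn ih =>
    rw [sum_Ioc_succ_top (by omega), mul_add]
    have hn : (0 : ℝ) < (n : ℝ) + 1 := by positivity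
    have hb := rpow_one_add_le_one_add_mul_self (s := 1 / ((n : ℝ) + 1)) (p := 1 - θ)
      (by have : 0 < 1 / ((n : ℝ) + 1) := by positivity
          linarith) (by linarith) (by linarith)
    have hs : (n : ℝ) + 1 + 1 = (n + 1) * (1 + 1 / ((n : ℝ) + 1)) := by field_simp
    have hp : ((n : ℝ) + 1) ^ (1 - θ) = (n + 1) / (n + 1) ^ θ := by
      rw [Real.rpow_sub hn, Real.rpow_one]
    have hm : ((n : ℝ) + 1 + 1) ^ (1 - θ) ≤ (n + 1) ^ (1 - θ) + (1 - θ) * (1 / (n + 1) ^ θ) := by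
      rw [hs, Real.mul_rpow hn.le (by positivity)]
      calc _ ≤ ((n : ℝ) + 1) ^ (1 - θ) * (1 + (1 - θ) * (1 / (n + 1))) := by gcongr
        _ = _ := by
          rw [hp]
          field_simp
    push_cast
    linarith

theorem sum_Icc_one_div_rpow_le {s : ℝ} (h0 : 0 < s) (h1 : s ≤ 1) {n : ℕ} (hn : 1 ≤ n) :
    ∑ k ∈ Icc 1 n, 1 / (k : ℝ) ^ (s + 1) ≤ 1 + (1 - 1 / (n : ℝ) ^ s) / s := by
  induction n, hn using Nat.le_induction with
  | base => simp
  | succ n hn ih =>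
    rw [sum_Icc_succ_top (by omega)]
    have hn0 : (0 : ℝ) < n := by exact_mod_cast hn
    have hn1 : (0 : ℝ) < (n : ℝ) + 1 := by positivity
    have hb := rpow_one_add_le_one_add_mul_self (s := -(1 / ((n : ℝ) + 1))) (p := s)
      (by have : 1 / ((n : ℝ) + 1) ≤ 1 := by
            rw [div_le_one hn1]; linarith
          linarith) h0.le h1
    have hs : 1 + -(1 / ((n : ℝ) + 1)) = n / (n + 1) := by field_simp; ring
    rw [hs, Real.div_rpow hn0.le hn1.le] at hb
    have hA : 0 < (n : ℝ) ^ s := by positivity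
    have hB : 0 < ((n : ℝ) + 1) ^ s := by positivity
    have hx : 0 < s / ((n : ℝ) + 1) := by positivity
    have hm : 1 / ((n : ℝ) + 1) ^ s * (1 + s / (n + 1)) ≤ 1 / (n : ℝ) ^ s := by
      rw [div_mul_eq_mul_div, one_mul, div_le_div_iff₀ hB hA]
      have h2 : (n : ℝ) ^ s ≤ (1 - s / (n + 1)) * ((n : ℝ) + 1) ^ s := by
        rw [div_le_iff₀ hB] at hb
        refine hb.trans_eq ?_
        ring
      nlinarith [mul_le_mul_of_nonneg_left h2 (by linarith : 0 ≤ 1 + s / ((n : ℝ) + 1)),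
        mul_pos (mul_pos hx hx) hB]
    have he : 1 / ((n : ℝ) + 1) ^ (s + 1) = (1 / ((n : ℝ) + 1) ^ s * (s / (n + 1))) / s := by
      rw [Real.rpow_add hn1, Real.rpow_one]
      field_simp
    push_cast
    rw [he]
    have : (1 / ((n : ℝ) + 1) ^ s * (s / (n + 1))) / s ≤
        (1 / (n : ℝ) ^ s - 1 / ((n : ℝ) + 1) ^ s) / s := by
      gcongr
      linarith
    have h3 : (1 - 1 / ((n : ℝ) + 1) ^ s) / s = (1 - 1 / (n : ℝ) ^ s) / s +
      (1 / (n : ℝ) ^ s - 1 / ((n : ℝ) + 1) ^ s) / s := by ring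
    linarith

theorem exp_neg_mul_le_rpow {y p : ℝ} (hy : 0 < y) (hp : 0 < p) :
    Real.exp (-(y * p)) ≤ (1 / (y * Real.exp 1)) ^ p := by
  have h := Real.add_one_le_exp (y - 1)
  have h2 : y * Real.exp 1 ≤ Real.exp y := by
    calc y * Real.exp 1 ≤ Real.exp (y - 1) * Real.exp 1 := by gcongr; linarith
      _ = Real.exp y := by rw [← Real.exp_add]; ring_nf
  rw [neg_mul_eq_neg_mul, Real.exp_mul, Real.exp_neg, ← one_div]
  gcongr

/-- The tail products telescope. -/
theorem sum_mul_prod_Ioc_sq_le {u : ℕ → ℝ} (t : ℕ) (hu : ∀ k ∈ Icc 1 t, u k ∈ Set.Icc (0 : ℝ) 1) :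
    ∑ k ∈ Icc 1 t, u k * (∏ l ∈ Ioc k t, (1 - u l)) ^ 2 ≤ 1 := by
  induction t with
  | zero => simp
  | succ t ih =>
    have hut := hu (t + 1) (by simp)
    have ih := ih fun k hk => hu k (by simp only [mem_Icc] at hk ⊢; omega)
    rw [sum_Icc_succ_top (by omega)]
    have : ∑ k ∈ Icc 1 t, u k * (∏ l ∈ Ioc k (t + 1), (1 - u l)) ^ 2 =
        (1 - u (t + 1)) ^ 2 * ∑ k ∈ Icc 1 t, u k * (∏ l ∈ Ioc k t, (1 - u l)) ^ 2 := by
      rw [mul_sum]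
      refine sum_congr rfl fun k hk => ?_
      rw [prod_Ioc_succ_top (by simp only [mem_Icc] at hk; omega)]
      ring
    rw [this]
    simp only [Ioc_self, prod_empty, one_pow, mul_one]
    nlinarith [hut.1, hut.2, mul_le_mul_of_nonneg_left ih (sq_nonneg (1 - u (t + 1)))]

theorem prod_Ioc_sq_le_exp {θ α : ℝ} (h0 : 0 < θ) (h1 : θ < 1) (hα0 : 0 < α) (hα1 : α ≤ 1)
    {k t : ℕ} (hkt : k ≤ t) :
    (∏ l ∈ Ioc k t, (1 - α / (l : ℝ) ^ θ)) ^ 2 ≤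
      Real.exp (-(2 * α / (1 - θ) * (((t : ℝ) + 1) ^ (1 - θ) - ((k : ℝ) + 1) ^ (1 - θ)))) := by
  have hle : ∀ l ∈ Ioc k t, 0 ≤ 1 - α / (l : ℝ) ^ θ := fun l hl => by
    have hl1 : (1 : ℝ) ≤ l := by
      simp only [mem_Ioc] at hl
      exact_mod_cast (by omega : 1 ≤ l)
    have : α / (l : ℝ) ^ θ ≤ 1 :=
      div_le_one_of_le₀ (hα1.trans (Real.one_le_rpow hl1 h0.le)) (by positivity)
    linarith
  have hprod : ∏ l ∈ Ioc k t, (1 - α / (l : ℝ) ^ θ) ≤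
      Real.exp (-(α * ∑ l ∈ Ioc k t, 1 / (l : ℝ) ^ θ)) := by
    rw [mul_sum, ← sum_neg_distrib, Real.exp_sum]
    refine prod_le_prod hle fun l _ => ?_
    rw [mul_one_div]
    exact Real.one_sub_le_exp_neg _
  have hsum := sub_rpow_le_mul_sum_Ioc h0 h1 hkt
  calc _ ≤ Real.exp (-(α * ∑ l ∈ Ioc k t, 1 / (l : ℝ) ^ θ)) ^ 2 := by
        gcongr
        exact prod_nonneg hle
    _ = Real.exp (-(2 * α / (1 - θ) * ((1 - θ) * ∑ l ∈ Ioc k t, 1 / (l : ℝ) ^ θ))) := by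
        have : 1 - θ ≠ 0 := by linarith
        rw [← Real.exp_nat_mul]
        congr 1
        field_simp
        push_cast
        ring
    _ ≤ _ := by
        have : 0 < 1 - θ := by linarith
        gcongr

theorem sum_sq_stepsize_mul_prod_le {θ α : ℝ} (hθ : θ ∈ Set.Ioo (1/2 : ℝ) 1) (hα : α ∈ Set.Ioc (0 : ℝ) 1)
    {t : ℕ} (ht : 1 ≤ t) :
    ∑ i ∈ Icc 1 t, (1 / (i : ℝ) ^ θ * ∏ k ∈ Ioc i t, (1 - α / (k : ℝ) ^ θ)) ^ 2 ≤
      (8 + 2 / (2 * θ - 1) * (θ / (Real.exp 1 * (2 - 2 ^ θ))) ^ (θ / (1 - θ))) *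
        (1 / α) ^ (θ / (1 - θ)) * (1 / ((t : ℝ) + 1)) ^ θ := by
  obtain ⟨hθ0, hθ1⟩ := hθ
  obtain ⟨hα0, hα1⟩ := hα
  have hθ : 0 < θ := by linarith
  have h1θ : 0 < 1 - θ := by linarith
  have hs : 0 < 2 * θ - 1 := by linarith
  have hN : (0 : ℝ) < (t : ℝ) + 1 := by positivity
  have h2θ : 0 < 2 - (2 : ℝ) ^ θ := by
    have := Real.rpow_lt_rpow_of_exponent_lt (x := 2) (by norm_num) hθ1
    rw [Real.rpow_one] at this
    linarith
  set p := θ / (1 - θ) with hp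
  have hp0 : 0 < p := by positivity
  have hp1 : 1 ≤ p := by rw [hp, le_div_iff₀ h1θ]; linarith
  have hu : ∀ k ∈ Icc 1 t, α / (k : ℝ) ^ θ ∈ Set.Icc (0 : ℝ) 1 := fun l hl => by
    have hl1 : (1 : ℝ) ≤ l := by
      simp only [mem_Icc] at hl
      exact_mod_cast hl.1
    exact ⟨by positivity,
      div_le_one_of_le₀ (hα1.trans (Real.one_le_rpow hl1 hθ.le)) (by positivity)⟩
  have hα' : 1 / α ≤ (1 / α) ^ p := by
    simpa using Real.rpow_le_rpow_of_exponent_le (one_le_one_div hα0 hα1) hp1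
  -- indices in the upper half
  have hupper : ∑ i ∈ Icc 1 t with t ≤ 2 * i,
      (1 / (i : ℝ) ^ θ * ∏ k ∈ Ioc i t, (1 - α / (k : ℝ) ^ θ)) ^ 2 ≤
        8 * (1 / α) ^ p * (1 / ((t : ℝ) + 1)) ^ θ := by
    calc _ ≤ ∑ i ∈ Icc 1 t with t ≤ 2 * i, 3 * (1 / ((t : ℝ) + 1)) ^ θ * (1 / α) *
          (α / (i : ℝ) ^ θ * (∏ k ∈ Ioc i t, (1 - α / (k : ℝ) ^ θ)) ^ 2) := by
          refine sum_le_sum fun i hi => ?_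
          simp only [mem_filter, mem_Icc] at hi
          have hi1 : (1 : ℝ) ≤ i := by exact_mod_cast hi.1.1
          have hi2 : (t : ℝ) ≤ 2 * i := by exact_mod_cast hi.2
          have h3 : 1 / (i : ℝ) ^ θ ≤ 3 * (1 / ((t : ℝ) + 1)) ^ θ := by
            calc 1 / (i : ℝ) ^ θ = (1 / (i : ℝ)) ^ θ := by
                  rw [Real.div_rpow (by norm_num) (by positivity), Real.one_rpow]
              _ ≤ (3 * (1 / ((t : ℝ) + 1))) ^ θ := by
                  gcongr
                  rw [mul_one_div, div_le_div_iff₀ (by positivity) hN]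
                  linarith
              _ = 3 ^ θ * (1 / ((t : ℝ) + 1)) ^ θ := by
                  rw [Real.mul_rpow (by norm_num) (by positivity)]
              _ ≤ _ := by
                  gcongr
                  simpa using Real.rpow_le_rpow_of_exponent_le (x := 3) (by norm_num) hθ1.le
          calc _ = 1 / (i : ℝ) ^ θ * (1 / (i : ℝ) ^ θ *
                  (∏ k ∈ Ioc i t, (1 - α / (k : ℝ) ^ θ)) ^ 2) := by ring
            _ ≤ 3 * (1 / ((t : ℝ) + 1)) ^ θ * (1 / (i : ℝ) ^ θ *
                  (∏ k ∈ Ioc i t, (1 - α / (k : ℝ) ^ θ)) ^ 2) := by gcongr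
            _ = _ := by field_simp
      _ ≤ 3 * (1 / ((t : ℝ) + 1)) ^ θ * (1 / α) * 1 := by
          rw [← mul_sum]
          gcongr
          refine le_trans (sum_le_sum_of_subset_of_nonneg (filter_subset _ _) ?_)
            (sum_mul_prod_Ioc_sq_le t hu)
          intro i hi _
          exact mul_nonneg (hu i hi).1 (sq_nonneg _)
      _ ≤ 8 * (1 / ((t : ℝ) + 1)) ^ θ * (1 / α) ^ p * 1 := by
          gcongr
          norm_num
      _ = _ := by ring
  -- indices in the lower half
  have hlower : ∑ i ∈ Icc 1 t with ¬ t ≤ 2 * i,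
      (1 / (i : ℝ) ^ θ * ∏ k ∈ Ioc i t, (1 - α / (k : ℝ) ^ θ)) ^ 2 ≤
        2 / (2 * θ - 1) * (θ / (Real.exp 1 * (2 - 2 ^ θ))) ^ p *
          (1 / α) ^ p * (1 / ((t : ℝ) + 1)) ^ θ := by
    set y := α * (2 - 2 ^ θ) * ((t : ℝ) + 1) ^ (1 - θ) / θ with hy
    have hy0 : 0 < y := by positivity
    have hexp : ∀ i : ℕ, i ≤ t → 2 * i < t →
        (∏ k ∈ Ioc i t, (1 - α / (k : ℝ) ^ θ)) ^ 2 ≤ Real.exp (-(y * p)) := fun i hit hi => by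
      refine (prod_Ioc_sq_le_exp hθ hθ1 hα0 hα1 hit).trans ?_
      have hi' : 2 * ((i : ℝ) + 1) ≤ t + 1 := by exact_mod_cast (by omega : 2 * (i + 1) ≤ t + 1)
      have h1 : ((i : ℝ) + 1) ^ (1 - θ) ≤ 2 ^ θ / 2 * ((t : ℝ) + 1) ^ (1 - θ) := by
        calc ((i : ℝ) + 1) ^ (1 - θ) ≤ (((t : ℝ) + 1) / 2) ^ (1 - θ) := by
              gcongr
              linarith
          _ = _ := by
              rw [Real.div_rpow hN.le (by norm_num), Real.rpow_sub (x := 2) (by norm_num),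
                Real.rpow_one]
              field_simp
      have h2 : y * p = 2 * α / (1 - θ) *
          (((t : ℝ) + 1) ^ (1 - θ) - 2 ^ θ / 2 * ((t : ℝ) + 1) ^ (1 - θ)) := by
        rw [hy, hp]
        field_simp
      rw [h2]
      gcongr
    have hfin : Real.exp (-(y * p)) ≤ (θ / (Real.exp 1 * (2 - 2 ^ θ))) ^ p *
          (1 / α) ^ p * (1 / ((t : ℝ) + 1)) ^ θ := by
      refine (exp_neg_mul_le_rpow hy0 hp0).trans_eq ?_
      have h3 : (1 / ((t : ℝ) + 1)) ^ θ = ((1 / ((t : ℝ) + 1)) ^ (1 - θ)) ^ p := by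
        rw [← Real.rpow_mul (by positivity), hp]
        congr 1
        field_simp
      rw [h3, ← Real.mul_rpow (by positivity) (by positivity),
        ← Real.mul_rpow (by positivity) (by positivity)]
      congr 1
      rw [Real.div_rpow (by norm_num) hN.le, Real.one_rpow, hy]
      field_simp
    have hzeta : ∑ k ∈ Icc 1 t, 1 / (k : ℝ) ^ (2 * θ) ≤ 2 / (2 * θ - 1) := by
      have h := sum_Icc_one_div_rpow_le hs (by linarith) ht
      rw [sub_add_cancel] at h
      refine h.trans ?_
      have h4 : (0 : ℝ) < 1 / (t : ℝ) ^ (2 * θ - 1) := by positivity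
      rw [le_div_iff₀ hs, add_mul, div_mul_cancel₀ _ hs.ne']
      linarith
    calc _ ≤ ∑ i ∈ Icc 1 t with ¬ t ≤ 2 * i, 1 / (i : ℝ) ^ (2 * θ) * Real.exp (-(y * p)) := by
          refine sum_le_sum fun i hi => ?_
          simp only [mem_filter, mem_Icc, not_le] at hi
          have hsq : (1 / (i : ℝ) ^ θ) ^ 2 = 1 / (i : ℝ) ^ (2 * θ) := by
            rw [div_pow, one_pow, mul_comm, Real.rpow_mul (by positivity)]
            norm_num
          rw [mul_pow, hsq]
          gcongr
          exact hexp i hi.1.2 hi.2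
      _ ≤ ∑ i ∈ Icc 1 t, 1 / (i : ℝ) ^ (2 * θ) * Real.exp (-(y * p)) :=
          sum_le_sum_of_subset_of_nonneg (filter_subset _ _) fun i _ _ => by positivity
      _ ≤ 2 / (2 * θ - 1) * ((θ / (Real.exp 1 * (2 - 2 ^ θ))) ^ p *
          (1 / α) ^ p * (1 / ((t : ℝ) + 1)) ^ θ) := by
          rw [← sum_mul]
          gcongr
      _ = _ := by ring
  rw [← sum_filter_add_sum_filter_not (Icc 1 t) (fun i => t ≤ 2 * i)]
  linarith

theorem sum_pow_le_of_injOn {ι : Type*} {r : ℝ} (hr0 : 0 < r) (hr1 : r < 1) {s : Finset ι}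
    {g : ι → ℕ} (hg : Set.InjOn g s) (hpos : ∀ x ∈ s, 1 ≤ g x) :
    ∑ x ∈ s, r ^ g x ≤ r / (1 - r) := by
  have hinj : Set.InjOn (fun x => g x - 1) s := fun x hx y hy hxy => by
    have := hpos x hx
    have := hpos y hy
    exact hg hx hy (by simp only at hxy; omega)
  calc ∑ x ∈ s, r ^ g x = r * ∑ x ∈ s, r ^ (g x - 1) := by
        rw [mul_sum]
        refine sum_congr rfl fun x hx => ?_
        rw [← pow_succ', Nat.sub_add_cancel (hpos x hx)]
    _ = r * ∑ m ∈ s.image fun x => g x - 1, r ^ m := by rw [sum_image hinj]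
    _ ≤ r * (1 - r)⁻¹ := by
        gcongr
        rw [← tsum_geometric_of_lt_one hr0.le hr1]
        exact (summable_geometric_of_lt_one hr0.le hr1).sum_le_tsum _ fun m _ => by positivity
    _ = r / (1 - r) := (div_eq_mul_inv _ _).symm

theorem sum_mul_geometric_le {r : ℝ} (hr0 : 0 < r) (hr1 : r < 1) (a : ℕ → ℝ) (t : ℕ) :
    ∑ i ∈ Icc 1 t, ∑ j ∈ Ioc i t, a i * a j * r ^ (j - i) ≤
      r / (1 - r) * ∑ i ∈ Icc 1 t, a i ^ 2 := by
  have hcomm : ∑ i ∈ Icc 1 t, ∑ j ∈ Ioc i t, a j ^ 2 * r ^ (j - i) =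
      ∑ j ∈ Icc 1 t, ∑ i ∈ Ico 1 j, a j ^ 2 * r ^ (j - i) :=
    sum_comm' fun i j => by simp only [mem_Icc, mem_Ioc, mem_Ico]; omega
  have h1 : ∑ i ∈ Icc 1 t, ∑ j ∈ Ioc i t, a i ^ 2 * r ^ (j - i) ≤
      r / (1 - r) * ∑ i ∈ Icc 1 t, a i ^ 2 := by
    rw [mul_sum]
    refine sum_le_sum fun i _ => ?_
    rw [← mul_sum, mul_comm]
    gcongr
    refine sum_pow_le_of_injOn hr0 hr1 (fun x hx y hy hxy => ?_) fun x hx => ?_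
    · simp only [coe_Ioc, Set.mem_Ioc] at hx hy hxy
      omega
    · simp only [mem_Ioc] at hx
      omega
  have h2 : ∑ i ∈ Icc 1 t, ∑ j ∈ Ioc i t, a j ^ 2 * r ^ (j - i) ≤
      r / (1 - r) * ∑ i ∈ Icc 1 t, a i ^ 2 := by
    rw [hcomm, mul_sum]
    refine sum_le_sum fun j _ => ?_
    rw [← mul_sum, mul_comm]
    gcongr
    refine sum_pow_le_of_injOn hr0 hr1 (fun x hx y hy hxy => ?_) fun x hx => ?_
    · simp only [coe_Ico, Set.mem_Ico] at hx hy hxy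
      omega
    · simp only [mem_Ico] at hx
      omega
  have h3 : ∑ i ∈ Icc 1 t, ∑ j ∈ Ioc i t, a i * a j * r ^ (j - i) ≤
      ∑ i ∈ Icc 1 t, ∑ j ∈ Ioc i t, (a i ^ 2 * r ^ (j - i) + a j ^ 2 * r ^ (j - i)) / 2 := by
    refine sum_le_sum fun i _ => sum_le_sum fun j _ => ?_
    nlinarith [mul_nonneg (sq_nonneg (a i - a j)) (pow_pos hr0 (j - i)).le]
  simp_rw [← sum_div, sum_add_distrib] at h3
  linarith

end RealSums

section Mixing

variable {Z : Type*} [MeasurableSpace Z]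

theorem abs_integral_sub_le_of_abs_measureReal_sub_le {μ ν : Measure Z} [IsProbabilityMeasure μ]
    [IsProbabilityMeasure ν] {g : Z → ℝ} (hg : Measurable g) {c ε : ℝ} (hc : 0 ≤ c)
    (hbd : ∀ z, |g z| ≤ c)
    (hε : ∀ B, MeasurableSet B → |μ.real B - ν.real B| ≤ ε) :
    |∫ z, g z ∂μ - ∫ z, g z ∂ν| ≤ 2 * c * ε := by
  have hint : ∀ η : Measure Z, IsProbabilityMeasure η → Integrable g η := fun η _ =>
    Integrable.of_bound hg.aestronglyMeasurable c (.of_forall hbd)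
  have hcake : ∀ η : Measure Z, IsProbabilityMeasure η →
      ∫ z, g z ∂η = (∫ s in Set.Ioc 0 (2 * c), η.real {z | s ≤ g z + c}) - c := fun η _ => by
    have h := ((hint η ‹_›).add (integrable_const c)).integral_eq_integral_Ioc_meas_le (M := 2 * c)
      (.of_forall fun z => by
        have := (abs_le.1 (hbd z)).1
        simp only [Pi.zero_apply, Pi.add_apply]
        linarith)
      (.of_forall fun z => by
        have := (abs_le.1 (hbd z)).2
        simp only [Pi.add_apply]
        linarith)
    simp only [Pi.add_apply] at h
    rw [← h, integral_add (hint η ‹_›) (integrable_const c)]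
    simp
  have hlevel : ∀ η : Measure Z, IsProbabilityMeasure η →
      IntegrableOn (fun s => η.real {z | s ≤ g z + c}) (Set.Ioc 0 (2 * c)) := fun η _ => by
    have hanti : Antitone fun s => η.real {z | s ≤ g z + c} := fun s s' hs =>
      measureReal_mono fun z hz => hs.trans hz
    exact Integrable.of_bound hanti.measurable.aestronglyMeasurable 1
      (.of_forall fun s => by
        rw [Real.norm_of_nonneg measureReal_nonneg]
        exact measureReal_le_one)
  rw [hcake μ ‹_›, hcake ν ‹_›, sub_sub_sub_cancel_right,
    ← integral_sub (hlevel μ ‹_›) (hlevel ν ‹_›)]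
  have h := norm_setIntegral_le_of_norm_le_const (μ := volume) (s := Set.Ioc 0 (2 * c))
    (f := fun s => μ.real {z | s ≤ g z + c} - ν.real {z | s ≤ g z + c}) measure_Ioc_lt_top
    fun s _ => hε _ (measurableSet_le measurable_const (hg.add_const c))
  refine h.trans_eq ?_
  rw [Real.volume_real_Ioc_of_le (by linarith)]
  ring

instance kernelIter.instIsMarkovKernel (P : Kernel Z Z) [IsMarkovKernel P] (m : ℕ) :
    IsMarkovKernel (kernelIter P m) := by
  induction m with
  | zero => rw [kernelIter]; infer_instance
  | succ m ih => rw [kernelIter]; infer_instance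

theorem abs_measureReal_sub_le_one (μ ν : Measure Z) [IsProbabilityMeasure μ]
    [IsProbabilityMeasure ν] (B : Set Z) : |μ.real B - ν.real B| ≤ 1 :=
  abs_sub_le_of_nonneg_of_le measureReal_nonneg measureReal_le_one measureReal_nonneg
    measureReal_le_one

theorem ae_abs_kernelIter_sub_le_phiCoef (P : Kernel Z Z) [IsMarkovKernel P] (ρ : Measure Z)
    [IsProbabilityMeasure ρ] (m : ℕ) :
    ∀ᵐ z ∂ρ, ∀ B, MeasurableSet B →
      |(kernelIter P m z).real B - ρ.real B| ≤ phiCoef P ρ m := by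
  have hbd : ∀ z, ∀ B : {B : Set Z // MeasurableSet B},
      |(kernelIter P m z B.1).toReal - (ρ B.1).toReal| ≤ 1 := fun z B =>
    abs_measureReal_sub_le_one _ _ B.1
  have hne : Nonempty {B : Set Z // MeasurableSet B} := ⟨⟨∅, .empty⟩⟩
  have h := ae_le_essSup (μ := ρ) (f := fun z => ⨆ B : {B : Set Z // MeasurableSet B},
    |(kernelIter P m z B.1).toReal - (ρ B.1).toReal|)
    (Filter.isBoundedUnder_of ⟨1, fun z => ciSup_le (hbd z)⟩)
  filter_upwards [h] with z hz B hB
  exact (le_ciSup (f := fun B : {B : Set Z // MeasurableSet B} =>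
    |(kernelIter P m z B.1).toReal - (ρ B.1).toReal|)
    ⟨1, by rintro _ ⟨B, rfl⟩; exact hbd z B⟩ ⟨B, hB⟩).trans hz

theorem integral_integral_inner_le_phiCoef {W : Type*} [NormedAddCommGroup W]
    [InnerProductSpace ℝ W] [CompleteSpace W] (P : Kernel Z Z) [IsMarkovKernel P] (ρ : Measure Z)
    [IsProbabilityMeasure ρ] {f : Z → W} (hf : StronglyMeasurable f) (hf_int : Integrable f ρ)
    (hf_mean : ∫ z, f z ∂ρ = 0) {σ : ℝ} (hσ : 0 ≤ σ) (hf_bd : ∀ z, ‖f z‖ ≤ σ) (m : ℕ) :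
    ∫ z, ∫ z', ⟪f z, f z'⟫ ∂(kernelIter P m z) ∂ρ ≤ 2 * σ ^ 2 * phiCoef P ρ m := by
  have h : ∀ᵐ z ∂ρ, ‖∫ z', ⟪f z, f z'⟫ ∂(kernelIter P m z)‖ ≤ 2 * σ ^ 2 * phiCoef P ρ m := by
    filter_upwards [ae_abs_kernelIter_sub_le_phiCoef P ρ m] with z hz
    have hmean : ∫ z', ⟪f z, f z'⟫ ∂ρ = 0 := by
      rw [integral_inner hf_int, hf_mean, inner_zero_right]
    have hdiff := abs_integral_sub_le_of_abs_measureReal_sub_le (c := σ ^ 2)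
      (stronglyMeasurable_const.inner hf : StronglyMeasurable fun z' => ⟪f z, f z'⟫).measurable
      (sq_nonneg σ) (fun z' => (abs_real_inner_le_norm _ _).trans (by
        rw [sq]
        exact mul_le_mul (hf_bd z) (hf_bd z') (norm_nonneg _) hσ)) hz
    rwa [hmean, sub_zero] at hdiff
  simpa using (le_abs_self _).trans (norm_integral_le_of_norm_le_const h)

end Mixing

theorem cross_term_bound_phi_mixing
    {Z : Type*} [MeasurableSpace Z]
    {W : Type*} [NormedAddCommGroup W] [InnerProductSpace ℝ W] [CompleteSpace W]
    (P : Kernel Z Z) [IsMarkovKernel P]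
    (ρ : Measure Z) [IsProbabilityMeasure ρ]
    (hinv : ρ.bind (fun z => P z) = ρ)
    (f : Z → W) (hf_meas : StronglyMeasurable f) (hf_int : Integrable f ρ)
    (hf_mean : ∫ z, f z ∂ρ = 0)
    (σ : ℝ) (hσ : 0 ≤ σ) (hf_bd : ∀ z, ‖f z‖ ≤ σ)
    (θ α : ℝ) (hθ : θ ∈ Set.Ioo (1/2 : ℝ) 1) (hα : α ∈ Set.Ioc (0 : ℝ) 1)
    (D r : ℝ) (hD : 0 < D) (hr0 : 0 < r) (hr1 : r < 1)
    (hphi : ∀ m : ℕ, 1 ≤ m → phiCoef P ρ m ≤ D * r ^ m)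
    (t : ℕ) (ht : 1 ≤ t) :
    2 * ∑ i ∈ Finset.Icc 1 t, ∑ j ∈ Finset.Ioc i t,
        (1 / (i : ℝ) ^ θ) * (1 / (j : ℝ) ^ θ) *
          (∏ k ∈ Finset.Ioc i t, (1 - α / (k : ℝ) ^ θ)) *
          (∏ l ∈ Finset.Ioc j t, (1 - α / (l : ℝ) ^ θ)) *
          (∫ z, ∫ z', ⟪f z, f z'⟫ ∂(kernelIter P (j - i) z) ∂ρ) ≤
      4 * σ ^ 2 * (D * r / (1 - r)) *
        (8 + 2 / (2 * θ - 1) * (θ / (Real.exp 1 * (2 - 2 ^ θ))) ^ (θ / (1 - θ))) *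
        (1 / α) ^ (θ / (1 - θ)) * (1 / ((t : ℝ) + 1)) ^ θ := by
  set a : ℕ → ℝ := fun i => 1 / (i : ℝ) ^ θ * ∏ k ∈ Finset.Ioc i t, (1 - α / (k : ℝ) ^ θ) with ha
  have ha0 : ∀ i, 0 ≤ a i := fun i => by
    refine mul_nonneg (by positivity) (Finset.prod_nonneg fun k hk => ?_)
    have hk1 : (1 : ℝ) ≤ k := by
      rw [Finset.mem_Ioc] at hk
      exact_mod_cast (by omega : 1 ≤ k)
    exact sub_nonneg.2 (div_le_one_of_le₀
      (hα.2.trans (Real.one_le_rpow hk1 (by linarith [hθ.1]))) (by positivity))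
  have hterm : ∀ i ∈ Finset.Icc 1 t, ∀ j ∈ Finset.Ioc i t,
      (1 / (i : ℝ) ^ θ) * (1 / (j : ℝ) ^ θ) *
          (∏ k ∈ Finset.Ioc i t, (1 - α / (k : ℝ) ^ θ)) *
          (∏ l ∈ Finset.Ioc j t, (1 - α / (l : ℝ) ^ θ)) *
          (∫ z, ∫ z', ⟪f z, f z'⟫ ∂(kernelIter P (j - i) z) ∂ρ) ≤
        2 * σ ^ 2 * D * (a i * a j * r ^ (j - i)) := fun i _ j hj => by
    have hji : 1 ≤ j - i := by
      rw [Finset.mem_Ioc] at hj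
      omega
    calc _ = a i * a j * (∫ z, ∫ z', ⟪f z, f z'⟫ ∂(kernelIter P (j - i) z) ∂ρ) := by
          rw [ha]
          ring
      _ ≤ a i * a j * (2 * σ ^ 2 * (D * r ^ (j - i))) := by
          refine mul_le_mul_of_nonneg_left ?_ (mul_nonneg (ha0 i) (ha0 j))
          refine (integral_integral_inner_le_phiCoef P ρ hf_meas hf_int hf_mean hσ hf_bd _).trans ?_
          gcongr
          exact hphi _ hji
      _ = _ := by ring
  have h1r : 0 < 1 - r := by linarith
  calc _ ≤ 2 * ∑ i ∈ Finset.Icc 1 t, ∑ j ∈ Finset.Ioc i t,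
        2 * σ ^ 2 * D * (a i * a j * r ^ (j - i)) := by
        gcongr 2 * ?_
        exact Finset.sum_le_sum fun i hi => Finset.sum_le_sum fun j hj => hterm i hi j hj
    _ = 4 * σ ^ 2 * D *
        ∑ i ∈ Finset.Icc 1 t, ∑ j ∈ Finset.Ioc i t, a i * a j * r ^ (j - i) := by
        simp_rw [← Finset.mul_sum]
        ring
    _ ≤ 4 * σ ^ 2 * D * (r / (1 - r) * ∑ i ∈ Finset.Icc 1 t, a i ^ 2) := by
        gcongr
        exact sum_mul_geometric_le hr0 hr1 a t
    _ ≤ 4 * σ ^ 2 * D * (r / (1 - r) *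
        ((8 + 2 / (2 * θ - 1) * (θ / (Real.exp 1 * (2 - 2 ^ θ))) ^ (θ / (1 - θ))) *
          (1 / α) ^ (θ / (1 - θ)) * (1 / ((t : ℝ) + 1)) ^ θ)) := by
        gcongr
        exact sum_sq_stepsize_mul_prod_le hθ hα ht
    _ = _ := by ring
end
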